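/- Let u, v, w be signed permutations of [n] with d(u) + d(v) = d(w). Consider the family of n admissible subsets of [±n] (with multiplicity) consisting of u[i] for each B-descent i of u, v[i] for each B-descent i of v, and w[i] for each B-ascent i of w. If this family can be ordered into a chain S_1 ⊆ … ⊆ S_n, then in R^B_n one has (∏_{i a B-descent of u} τ_{u[i]})·(∏_{i a B-descent of v} τ_{v[i]})·(∏_{i a B-ascent of w} τ_{w[i]}) = 2^{n−λ_1}·I(λ)·τ_{{1}}·τ_{{1,2}}⋯τ_{{1,…,n}}, where λ is the Young diagram consisting of the cardinalities |S_1|,…,|S_n| in weakly decreasing order. If the family cannot be so ordered, the left-hand side is 0 in R^B_n. -/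

import Mathlib

open MvPolynomial

/-- The set `[±n]`, realized as `Fin n × Bool`: `(k, true) ↔ k+1` and `(k, false) ↔ −(k+1)`. -/
abbrev PM (n : ℕ) := Fin n × Bool

/-- Negation on `[±n]`. -/
def negPM {n : ℕ} (p : PM n) : PM n := (p.1, !p.2)

/-- A subset `S ⊆ [±n]` is admissible if it is nonempty and contains no pair `{i, −i}`. -/
def Adm (n : ℕ) (S : Finset (PM n)) : Prop :=
  S.Nonempty ∧ ∀ p ∈ S, negPM p ∉ S

instance (n : ℕ) (S : Finset (PM n)) : Decidable (Adm n S) := by unfold Adm; infer_instance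

/-- Index type of the variables of `R^B_n`: the admissible subsets of `[±n]`. -/
abbrev IdxB (n : ℕ) := {S : Finset (PM n) // Adm n S}

/-- Generators of the defining ideal of `R^B_n`: (i) products `τ_S τ_T` for incomparable `S, T`;
(ii) the linear relations `Σ_{k∈S} τ_S − Σ_{−k∈S} τ_S` for `k ∈ {1,…,n}`. -/
def relB (n : ℕ) : Set (MvPolynomial (IdxB n) ℤ) :=
  {p | ∃ S T : IdxB n, ¬ S.1 ⊆ T.1 ∧ ¬ T.1 ⊆ S.1 ∧ p = X S * X T} ∪
  {p | ∃ k : Fin n, p =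
      (∑ S : IdxB n, if (k, true) ∈ S.1 then X S else 0) -
      (∑ S : IdxB n, if (k, false) ∈ S.1 then X S else 0)}

/-- The ring `R^B_n`. -/
abbrev RB (n : ℕ) := MvPolynomial (IdxB n) ℤ ⧸ Ideal.span (relB n)

/-- The class `τ_S ∈ R^B_n` of an admissible subset `S ⊆ [±n]`. -/
noncomputable def tauB (n : ℕ) (S : Finset (PM n)) : RB n :=
  if h : Adm n S then Ideal.Quotient.mk _ (X (⟨S, h⟩ : IdxB n)) else 1

/-- The subset `{1,…,i}` of `[±n]`. -/
def initSegB (n i : ℕ) : Finset (PM n) :=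
  Finset.univ.filter (fun p : PM n => p.2 = true ∧ (p.1 : ℕ) < i)

/-- The class of a point: `τ_{{1}} ⋯ τ_{{1,…,n}}`. -/
noncomputable def ptB (n : ℕ) : RB n := ∏ i ∈ Finset.Icc 1 n, tauB n (initSegB n i)


/-- `λ_i` extended by `0` for `i > n`. -/
def lamE (n : ℕ) (lam : ℕ → ℕ) (i : ℕ) : ℕ := if i ≤ n then lam i else 0

/-- The sorted list `i_1 < … < i_s` of lower-right corners of `λ`. -/
def cornerL (n : ℕ) (lam : ℕ → ℕ) : List ℕ :=
  ((Finset.Icc 1 n).filter (fun i => lamE n lam (i + 1) < lamE n lam i)).sort (· ≤ ·)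

/-- The number `s` of lower-right corners of `λ`. -/
def sC (n : ℕ) (lam : ℕ → ℕ) : ℕ := (cornerL n lam).length

/-- `i_r` (with `i_0 = 0`; out-of-range indices default to `n+1`, where `λ` vanishes). -/
def iC (n : ℕ) (lam : ℕ → ℕ) (r : ℕ) : ℕ :=
  if r = 0 then 0 else (cornerL n lam).getD (r - 1) (n + 1)

/-- `a_r = i_r − i_{r−1} − 1`. -/
def aC (n : ℕ) (lam : ℕ → ℕ) (r : ℕ) : ℤ := (iC n lam r : ℤ) - iC n lam (r - 1) - 1

/-- `b_r = λ_{i_r} − λ_{i_{r+1}} − 1` (with `λ_{i_{s+1}} = 0`). -/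
def bC (n : ℕ) (lam : ℕ → ℕ) (r : ℕ) : ℤ :=
  (lamE n lam (iC n lam r) : ℤ) - lamE n lam (iC n lam (r + 1)) - 1

/-- `c_r = λ_{i_r} + i_r − n − 1`. -/
def cC (n : ℕ) (lam : ℕ → ℕ) (r : ℕ) : ℤ :=
  (lamE n lam (iC n lam r) : ℤ) + iC n lam r - n - 1

/-- Binomial coefficient `C(x,y)` with `C(x,y) = 0` unless `0 ≤ y ≤ x`. -/
def Cb (x y : ℤ) : ℤ := if 0 ≤ y ∧ y ≤ x then (x.toNat.choose y.toNat : ℤ) else 0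

/-- `y_r = C(a_r, c_r) · C(b_r, c_r)`. -/
def yC (n : ℕ) (lam : ℕ → ℕ) (r : ℕ) : ℤ :=
  Cb (aC n lam r) (cC n lam r) * Cb (bC n lam r) (cC n lam r)

/-- `I(λ) = (−1)^{n+s} y_1 ⋯ y_s`. -/
def IY (n : ℕ) (lam : ℕ → ℕ) : ℤ :=
  (-1) ^ (n + sC n lam) * ∏ r ∈ Finset.Icc 1 (sC n lam), yC n lam r

/-- A signed permutation is a permutation of `[±n]` commuting with negation. -/
def IsSigned {n : ℕ} (u : Equiv.Perm (PM n)) : Prop := ∀ p, u (negPM p) = negPM (u p)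

/-- The signed value `u(i) ∈ {±1,…,±n}` of `u` at the (1-indexed) position `i`. -/
def sval (n : ℕ) (u : Equiv.Perm (PM n)) (i : ℕ) : ℤ :=
  if h : i - 1 < n then
    (if (u (⟨i - 1, h⟩, true)).2 then ((u (⟨i - 1, h⟩, true)).1 : ℤ) + 1
     else -(((u (⟨i - 1, h⟩, true)).1 : ℤ) + 1))
  else 0

/-- `i ∈ [n]` is a B-descent of `u` if either `i ≤ n−1` and (`u(i) > u(i+1)` with the same sign,
or `u(i) < u(i+1)` with opposite signs), or `i = n` and `u(n) < 0`. -/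
def BDescents (n : ℕ) (u : Equiv.Perm (PM n)) : Finset ℕ :=
  (Finset.Icc 1 n).filter (fun i =>
    (i = n ∧ sval n u n < 0) ∨
    (i ≠ n ∧ ((sval n u (i + 1) < sval n u i ∧ 0 < sval n u i * sval n u (i + 1)) ∨
              (sval n u i < sval n u (i + 1) ∧ sval n u i * sval n u (i + 1) < 0))))

/-- The B-ascents of `u`: those `i ∈ [n]` which are not B-descents. -/
def BAscents (n : ℕ) (u : Equiv.Perm (PM n)) : Finset ℕ :=
  (Finset.Icc 1 n).filter (fun i =>
    ¬ ((i = n ∧ sval n u n < 0) ∨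
       (i ≠ n ∧ ((sval n u (i + 1) < sval n u i ∧ 0 < sval n u i * sval n u (i + 1)) ∨
                 (sval n u i < sval n u (i + 1) ∧ sval n u i * sval n u (i + 1) < 0)))))

/-- The subset `u[i] = {u(1),…,u(i)}` of `[±n]`. -/
def sSet (n : ℕ) (u : Equiv.Perm (PM n)) (i : ℕ) : Finset (PM n) :=
  (Finset.univ.filter (fun k : Fin n => (k : ℕ) < i)).image (fun k => u (k, true))

namespace TypeB

open Finset

lemma negPM_negPM {n : ℕ} (p : PM n) : negPM (negPM p) = p := by
  simp [negPM]

lemma _root_.Adm.of_subset {n : ℕ} {S T : Finset (PM n)} (hT : Adm n T) (hST : S ⊆ T)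
    (hS : S.Nonempty) : Adm n S :=
  ⟨hS, fun p hp hq => hT.2 p (hST hp) (hST hq)⟩

lemma _root_.Adm.injOn_fst {n : ℕ} {S : Finset (PM n)} (hS : Adm n S) :
    Set.InjOn Prod.fst (S : Set (PM n)) := by
  rintro ⟨a, b⟩ hp ⟨a', b'⟩ hq h
  simp only at h
  subst h
  have h1 := hS.2 _ hp
  by_contra hne
  apply h1
  have : negPM (a, b) = (a, b') := by
    cases b <;> cases b' <;> simp_all [negPM]
  rw [this]
  exact hq

lemma _root_.Adm.card_le {n : ℕ} {S : Finset (PM n)} (hS : Adm n S) : S.card ≤ n := by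
  have := Finset.card_image_of_injOn hS.injOn_fst
  rw [← this]
  simpa using Finset.card_le_univ (S.image Prod.fst)

lemma _root_.Adm.card_pos {n : ℕ} {S : Finset (PM n)} (hS : Adm n S) : 0 < S.card :=
  Finset.card_pos.2 hS.1

lemma tauB_of_adm {n : ℕ} {S : Finset (PM n)} (h : Adm n S) :
    tauB n S = Ideal.Quotient.mk (Ideal.span (relB n)) (X (⟨S, h⟩ : IdxB n)) := by
  simp [tauB, h]

lemma tauB_mul_eq_zero {n : ℕ} {S T : Finset (PM n)} (hS : Adm n S) (hT : Adm n T)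
    (h1 : ¬ S ⊆ T) (h2 : ¬ T ⊆ S) : tauB n S * tauB n T = 0 := by
  rw [tauB_of_adm hS, tauB_of_adm hT, ← map_mul, Ideal.Quotient.eq_zero_iff_mem]
  exact Ideal.subset_span (Or.inl ⟨⟨S, hS⟩, ⟨T, hT⟩, h1, h2, rfl⟩)

lemma mk_sum_ite {n : ℕ} (p : PM n) :
    Ideal.Quotient.mk (Ideal.span (relB n))
      (∑ S : IdxB n, if p ∈ S.1 then (X S : MvPolynomial (IdxB n) ℤ) else 0) =
    ∑ S with Adm n S ∧ p ∈ S, tauB n S := by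
  rw [map_sum, ← Finset.filter_filter, Finset.sum_filter (p := fun S => p ∈ S)]
  rw [← Finset.sum_subtype_of_mem (p := Adm n) _ (by simp)]
  rw [Finset.sum_bij (fun (S : IdxB n) _ => S)]
  · simp
  · simp
  · intro b _
    exact ⟨b, by simp, rfl⟩
  · rintro ⟨S, hS⟩ _
    simp only [tauB_of_adm hS]
    split_ifs <;> simp

/-- The linear relation of `RB n`, for either sign of the index. -/
lemma sum_tauB_mem_neg {n : ℕ} (p : PM n) :
    ∑ S with Adm n S ∧ p ∈ S, tauB n S = ∑ S with Adm n S ∧ negPM p ∈ S, tauB n S := by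
  have key : ∀ k : Fin n, ∑ S with Adm n S ∧ (k, true) ∈ S, tauB n S =
      ∑ S with Adm n S ∧ (k, false) ∈ S, tauB n S := by
    intro k
    rw [← mk_sum_ite, ← mk_sum_ite, ← sub_eq_zero, ← map_sub, Ideal.Quotient.eq_zero_iff_mem]
    exact Ideal.subset_span (Or.inr ⟨k, rfl⟩)
  obtain ⟨k, b⟩ := p
  cases b
  · exact (key k).symm
  · exact key k

/-- The monomial of a multiset of subsets. -/
noncomputable def monom (n : ℕ) (W : Multiset (Finset (PM n))) : RB n := (W.map (tauB n)).prod

lemma monom_cons {n : ℕ} (S : Finset (PM n)) (W : Multiset (Finset (PM n))) :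
    monom n (S ::ₘ W) = tauB n S * monom n W := by
  simp [monom]

/-- A multiset of admissible, pairwise comparable subsets. -/
def IsAdmChain {n : ℕ} (W : Multiset (Finset (PM n))) : Prop :=
  (∀ S ∈ W, Adm n S) ∧ ∀ S ∈ W, ∀ T ∈ W, S ⊆ T ∨ T ⊆ S

lemma tauB_mul_monom_eq_zero {n : ℕ} {S T : Finset (PM n)} {W : Multiset (Finset (PM n))}
    (hS : Adm n S) (hT : Adm n T) (hTW : T ∈ W) (h1 : ¬ S ⊆ T) (h2 : ¬ T ⊆ S) :
    tauB n S * monom n W = 0 := by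
  obtain ⟨W', rfl⟩ := Multiset.exists_cons_of_mem hTW
  rw [monom_cons, ← mul_assoc, tauB_mul_eq_zero hS hT h1 h2, zero_mul]

/-- If `k` lies in a member of `W`, the sum of `τ_S` over `S ∋ k` annihilates the monomial. -/
lemma sum_mem_mul_monom {n : ℕ} {T : Finset (PM n)} {W : Multiset (Finset (PM n))}
    (hT : Adm n T) (hTW : T ∈ W) {k : PM n} (hk : k ∈ T) :
    ∑ S with Adm n S ∧ k ∈ S, tauB n S * monom n W = 0 := by
  rw [← Finset.sum_mul, sum_tauB_mem_neg, Finset.sum_mul]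
  refine Finset.sum_eq_zero fun S hS => ?_
  simp only [mem_filter, mem_univ, true_and] at hS
  refine tauB_mul_monom_eq_zero hS.1 hT hTW (fun h => hT.2 k hk (h hS.2)) fun h => ?_
  exact hS.1.2 k (h hk) hS.2

/-- Expansion of a repeated top member of a chain. -/
lemma tauB_mul_monom_top {n : ℕ} {T U : Finset (PM n)} {W : Multiset (Finset (PM n))}
    (hW : IsAdmChain W) (hTW : T ∈ W) (hU : U = ∅ ∨ U ∈ W) {k : PM n} (hk : k ∈ T)
    (hkU : k ∉ U) :
    tauB n T * monom n W = -(∑ S with Adm n S ∧ insert k U ⊆ S ∧ S ⊂ T, tauB n S * monom n W)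
      - ∑ S with Adm n S ∧ T ⊂ S, tauB n S * monom n W := by
  have hT := hW.1 T hTW
  have h0 := sum_mem_mul_monom hT hTW hk
  have h1 : ∑ S with Adm n S ∧ k ∈ S, tauB n S * monom n W =
      ∑ S ∈ {T} ∪ (univ.filter (fun S => Adm n S ∧ insert k U ⊆ S ∧ S ⊂ T) ∪
        univ.filter (fun S => Adm n S ∧ T ⊂ S)), tauB n S * monom n W := by
    symm
    apply Finset.sum_subset
    · intro S hS
      simp only [mem_union, mem_singleton, mem_filter, mem_univ, true_and] at hS ⊢
      rcases hS with rfl | hS | hS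
      · exact ⟨hT, hk⟩
      · exact ⟨hS.1, hS.2.1 (mem_insert_self _ _)⟩
      · exact ⟨hS.1, hS.2.1 hk⟩
    · intro S hS hS'
      simp only [mem_union, mem_singleton, mem_filter, mem_univ, true_and, not_or] at hS hS'
      obtain ⟨hS1, hkS⟩ := hS
      obtain ⟨hne, hl, hr⟩ := hS'
      by_cases hST : S ⊆ T
      · have hss : S ⊂ T := hST.ssubset_of_ne hne
        have hUS : ¬ U ⊆ S := fun h => hl ⟨hS1, insert_subset hkS h, hss⟩
        rcases hU with rfl | hU
        · exact absurd (empty_subset _) hUS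
        · exact tauB_mul_monom_eq_zero hS1 (hW.1 U hU) hU (fun h => hkU (h hkS)) hUS
      · exact tauB_mul_monom_eq_zero hS1 hT hTW hST
          fun h => hr ⟨hS1, h.ssubset_of_ne (Ne.symm hne)⟩
  rw [h1, Finset.sum_union, Finset.sum_union, Finset.sum_singleton] at h0
  · linear_combination h0
  · rw [Finset.disjoint_filter]
    rintro S - ⟨-, -, h⟩ ⟨-, h'⟩
    exact h.2 h'.1
  · simp

/-- Expansion of a repeated member of a chain which is not the top one. -/
lemma tauB_mul_monom_mid {n : ℕ} {T U V : Finset (PM n)} {W : Multiset (Finset (PM n))}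
    (hW : IsAdmChain W) (hTW : T ∈ W) (hU : U = ∅ ∨ U ∈ W) (hV : V ∈ W) {k l : PM n} (hk : k ∈ T)
    (hkU : k ∉ U) (hl : l ∈ V) (hlT : l ∉ T) :
    tauB n T * monom n W = -(∑ S with Adm n S ∧ insert k U ⊆ S ∧ S ⊂ T, tauB n S * monom n W)
      - ∑ S with Adm n S ∧ T ⊂ S ∧ S ⊆ V.erase l, tauB n S * monom n W := by
  have hT := hW.1 T hTW
  rw [tauB_mul_monom_top hW hTW hU hk hkU]
  congr 1
  have h0 := sum_mem_mul_monom (hW.1 V hV) hV hl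
  have h2 : ∑ S with Adm n S ∧ l ∈ S, tauB n S * monom n W =
      ∑ S with Adm n S ∧ T ⊂ S ∧ l ∈ S, tauB n S * monom n W := by
    symm
    apply Finset.sum_subset
    · intro S hS
      simp only [mem_filter, mem_univ, true_and] at hS ⊢
      exact ⟨hS.1, hS.2.2⟩
    · intro S hS hS'
      simp only [mem_filter, mem_univ, true_and] at hS hS'
      refine tauB_mul_monom_eq_zero hS.1 hT hTW (fun h => hlT (h hS.2)) fun h => ?_
      exact hS' ⟨hS.1, ⟨h, fun h' => hlT (h' hS.2)⟩, hS.2⟩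
  rw [h2] at h0
  have h3 : ∑ S with Adm n S ∧ T ⊂ S ∧ l ∉ S, tauB n S * monom n W =
      ∑ S with Adm n S ∧ T ⊂ S ∧ S ⊆ V.erase l, tauB n S * monom n W := by
    symm
    apply Finset.sum_subset
    · intro S hS
      simp only [mem_filter, mem_univ, true_and] at hS ⊢
      exact ⟨hS.1, hS.2.1, fun h => notMem_erase _ _ (hS.2.2 h)⟩
    · intro S hS hS'
      simp only [mem_filter, mem_univ, true_and] at hS hS'
      refine tauB_mul_monom_eq_zero hS.1 (hW.1 V hV) hV (fun h => ?_) fun h => hS.2.2 (h hl)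
      exact hS' ⟨hS.1, hS.2.1, subset_erase.2 ⟨h, hS.2.2⟩⟩
  rw [← h3, ← Finset.sum_filter_add_sum_filter_not _ (fun S => l ∈ S), Finset.filter_filter,
    Finset.filter_filter]
  simp only [and_assoc]
  rw [h0, zero_add]

lemma sum_mem_notMem_mul_monom {n : ℕ} {U V : Finset (PM n)} {W : Multiset (Finset (PM n))}
    (hW : IsAdmChain W) (hV : V ∈ W) (hU : U = ∅ ∨ U ∈ W) {x y : PM n} (hxy : x ≠ y)
    (hxU : x ∉ U) (hyU : y ∉ U) (hVU : V = insert x (insert y U)) :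
    ∑ S with Adm n S ∧ y ∈ S ∧ x ∉ S, tauB n S * monom n W =
      tauB n (insert y U) * monom n W := by
  have hVA := hW.1 V hV
  have hadm : Adm n (insert y U) :=
    hVA.of_subset (hVU ▸ subset_insert _ _) (insert_nonempty _ _)
  rw [Finset.sum_eq_single (insert y U)]
  · intro S hS hne
    simp only [mem_filter, mem_univ, true_and] at hS
    obtain ⟨hSA, hyS, hxS⟩ := hS
    have hVS : ¬ V ⊆ S := fun h => hxS (h (hVU ▸ mem_insert_self _ _))
    by_cases hSV : S ⊆ V
    · by_cases hUS : U ⊆ S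
      · refine absurd (subset_antisymm ?_ (insert_subset hyS hUS)) hne
        rwa [hVU, subset_insert_iff_of_notMem hxS] at hSV
      · rcases hU with rfl | hU
        · exact absurd (empty_subset _) hUS
        · exact tauB_mul_monom_eq_zero hSA (hW.1 U hU) hU (fun h => hyU (h hyS)) hUS
    · exact tauB_mul_monom_eq_zero hSA hVA hV hSV hVS
  · intro h
    simp only [mem_filter, mem_univ, true_and] at h
    exact absurd ⟨hadm, mem_insert_self _ _, by simp [hxy, hxU]⟩ h

/-- Two completions of a chain missing a single step are equal. -/
lemma tauB_insert_mul_monom {n : ℕ} {U V : Finset (PM n)} {W : Multiset (Finset (PM n))}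
    (hW : IsAdmChain W) (hV : V ∈ W) (hU : U = ∅ ∨ U ∈ W) {x y : PM n} (hxy : x ≠ y)
    (hxU : x ∉ U) (hyU : y ∉ U) (hVU : V = insert x (insert y U)) :
    tauB n (insert y U) * monom n W = tauB n (insert x U) * monom n W := by
  have hVA := hW.1 V hV
  have hx : x ∈ V := hVU ▸ mem_insert_self _ _
  have hy : y ∈ V := hVU ▸ mem_insert_of_mem (mem_insert_self _ _)
  have h1 := sum_mem_mul_monom hVA hV hx
  have h2 := sum_mem_mul_monom hVA hV hy
  rw [← Finset.sum_filter_add_sum_filter_not _ (fun S => y ∈ S), Finset.filter_filter,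
    Finset.filter_filter] at h1
  rw [← Finset.sum_filter_add_sum_filter_not _ (fun S => x ∈ S), Finset.filter_filter,
    Finset.filter_filter] at h2
  simp only [and_assoc] at h1 h2
  rw [sum_mem_notMem_mul_monom hW hV hU hxy.symm hyU hxU (hVU.trans (insert_comm _ _ _))] at h1
  rw [sum_mem_notMem_mul_monom hW hV hU hxy hxU hyU hVU] at h2
  simp only [and_comm (a := y ∈ _)] at h2
  linear_combination h2 - h1

/-- The two completions of a chain missing only the top step are equal. -/
lemma tauB_insert_mul_monom_top {n : ℕ} {U : Finset (PM n)} {W : Multiset (Finset (PM n))}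
    (hW : IsAdmChain W) (hU : U = ∅ ∨ U ∈ W) {x : PM n}
    (hx : Adm n (insert x U)) (hnx : Adm n (insert (negPM x) U)) (hxU : x ∉ U) (hnxU : negPM x ∉ U)
    (hc : U.card + 1 = n) :
    tauB n (insert x U) * monom n W = tauB n (insert (negPM x) U) * monom n W := by
  have key : ∀ y : PM n, Adm n (insert y U) → y ∉ U →
      ∑ S with Adm n S ∧ y ∈ S, tauB n S * monom n W = tauB n (insert y U) * monom n W := by
    intro y hy hyU
    rw [Finset.sum_eq_single (insert y U)]
    · intro S hS hne
      simp only [mem_filter, mem_univ, true_and] at hS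
      obtain ⟨hSA, hyS⟩ := hS
      by_cases hUS : U ⊆ S
      · refine absurd (eq_of_subset_of_card_le (insert_subset hyS hUS) ?_).symm hne
        rw [card_insert_of_notMem hyU, hc]
        exact hSA.card_le
      · rcases hU with rfl | hU
        · exact absurd (empty_subset _) hUS
        · exact tauB_mul_monom_eq_zero hSA (hW.1 U hU) hU (fun h => hyU (h hyS)) hUS
    · intro h
      simp only [mem_filter, mem_univ, true_and] at h
      exact absurd ⟨hy, mem_insert_self _ _⟩ h
  rw [← key x hx hxU, ← key _ hnx hnxU, ← Finset.sum_mul, ← Finset.sum_mul, sum_tauB_mem_neg]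

/-- The flag of underlying sets of the nonempty suffixes of a word. -/
def flagSets {n : ℕ} : List (PM n) → Multiset (Finset (PM n))
  | [] => 0
  | x :: l => insert x l.toFinset ::ₘ flagSets l

lemma subset_of_mem_flagSets {n : ℕ} {l : List (PM n)} {S : Finset (PM n)}
    (h : S ∈ flagSets l) : S ⊆ l.toFinset ∧ S.Nonempty := by
  induction l with
  | nil => simp [flagSets] at h
  | cons x l ih =>
    simp only [flagSets, Multiset.mem_cons] at h
    rw [List.toFinset_cons]
    rcases h with rfl | h
    · exact ⟨Subset.rfl, insert_nonempty _ _⟩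
    · exact ⟨(ih h).1.trans (subset_insert _ _), (ih h).2⟩

lemma isAdmChain_flagSets {n : ℕ} {l : List (PM n)} (hl : ∀ p ∈ l, negPM p ∉ l) :
    IsAdmChain (flagSets l) := by
  constructor
  · intro S hS
    obtain ⟨h1, h2⟩ := subset_of_mem_flagSets hS
    exact ⟨h2, fun p hp hq => hl p (by simpa using h1 hp) (by simpa using h1 hq)⟩
  · clear hl
    induction l with
    | nil => simp [flagSets]
    | cons x l ih =>
      simp only [flagSets, Multiset.mem_cons]
      rintro S (rfl | hS) T (rfl | hT)
      · exact Or.inl Subset.rfl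
      · exact Or.inr ((subset_of_mem_flagSets hT).1.trans (subset_insert _ _))
      · exact Or.inl ((subset_of_mem_flagSets hS).1.trans (subset_insert _ _))
      · exact ih S hS T hT

lemma toFinset_mem_flagSets {n : ℕ} (l : List (PM n)) :
    l.toFinset = ∅ ∨ l.toFinset ∈ flagSets l := by
  cases l with
  | nil => simp
  | cons x l => right; simp [flagSets]

lemma monom_flagSets_perm {n : ℕ} {l l' : List (PM n)} (h : l.Perm l')
    (hl : ∀ p ∈ l, negPM p ∉ l) (hn : l.Nodup) :
    monom n (flagSets l) = monom n (flagSets l') := by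
  induction h with
  | nil => rfl
  | cons x h ih =>
    simp only [flagSets, monom_cons]
    rw [ih (fun p hp hq => hl p (List.mem_cons_of_mem _ hp) (List.mem_cons_of_mem _ hq))
      hn.of_cons, List.toFinset_eq_of_perm _ _ h]
  | swap x y l =>
    simp only [List.nodup_cons, List.mem_cons, not_or] at hn
    simp only [flagSets, monom_cons, List.toFinset_cons]
    have hc : IsAdmChain (insert x (insert y l.toFinset) ::ₘ flagSets l) := by
      have h1 := isAdmChain_flagSets hl
      simp only [flagSets, List.toFinset_cons, insert_comm y x] at h1
      refine ⟨fun S hS => h1.1 S ?_, fun S hS T hT => h1.2 S ?_ T ?_⟩ <;>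
      · simp only [Multiset.mem_cons] at *
        tauto
    have := tauB_insert_mul_monom hc (Multiset.mem_cons_self _ _)
      (U := l.toFinset) (x := x) (y := y) ((toFinset_mem_flagSets l).imp id
        (Multiset.mem_cons_of_mem)) (fun h => hn.1.1 h.symm) (by simpa using hn.2.1)
        (by simpa using hn.1.2) rfl
    simp only [monom_cons] at this
    rw [insert_comm y x]
    linear_combination -this
  | trans h1 h2 ih1 ih2 =>
    rw [ih1 hl hn]
    refine ih2 (fun p hp hq => hl p (h1.mem_iff.2 hp) (h1.mem_iff.2 hq)) (h1.nodup_iff.1 hn)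

lemma forall_negPM_notMem_cons {n : ℕ} {x : PM n} {l : List (PM n)}
    (hl : ∀ p ∈ x :: l, negPM p ∉ x :: l) (hn : (x :: l).Nodup) :
    ∀ p ∈ negPM x :: l, negPM p ∉ negPM x :: l := by
  have hxl : x ∉ l := (List.nodup_cons.1 hn).1
  intro p hp hq
  simp only [List.mem_cons] at hp hq
  rcases hp with rfl | hp
  · rw [negPM_negPM] at hq
    rcases hq with h | h
    · have := congrArg Prod.snd h
      simp [negPM] at this
    · exact hxl h
  · rcases hq with h | h
    · have : p = x := by rw [← negPM_negPM p, h, negPM_negPM]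
      exact hxl (this ▸ hp)
    · exact hl p (List.mem_cons_of_mem _ hp) (List.mem_cons_of_mem _ h)

lemma monom_flagSets_neg {n : ℕ} {x : PM n} {l : List (PM n)}
    (hl : ∀ p ∈ x :: l, negPM p ∉ x :: l) (hn : (x :: l).Nodup) (hc : (x :: l).length = n) :
    monom n (flagSets (x :: l)) = monom n (flagSets (negPM x :: l)) := by
  have hl' : ∀ p ∈ l, negPM p ∉ l := fun p hp hq =>
    hl p (List.mem_cons_of_mem _ hp) (List.mem_cons_of_mem _ hq)
  have hxl : x ∉ l := (List.nodup_cons.1 hn).1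
  have hnxl : negPM x ∉ l := fun h => hl x List.mem_cons_self (List.mem_cons_of_mem _ h)
  simp only [flagSets, monom_cons]
  refine tauB_insert_mul_monom_top (isAdmChain_flagSets hl') (toFinset_mem_flagSets l)
    ⟨insert_nonempty _ _, ?_⟩ ⟨insert_nonempty _ _, ?_⟩ (by simpa using hxl) (by simpa using hnxl)
    ?_
  · simpa using hl
  · simpa using forall_negPM_notMem_cons hl hn
  · exact (congrArg (· + 1) (List.toFinset_card_of_nodup hn.of_cons)).trans hc

/-- The standard complete word `n, …, 2, 1` truncated to its last `j` letters. -/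
def stdWord (n : ℕ) : (j : ℕ) → j ≤ n → List (PM n)
  | 0, _ => []
  | j + 1, h => (⟨j, h⟩, true) :: stdWord n j (by omega)

lemma stdWord_toFinset (n : ℕ) (j : ℕ) (h : j ≤ n) :
    (stdWord n j h).toFinset = initSegB n j := by
  induction j with
  | zero => simp [stdWord, initSegB]
  | succ j ih =>
    rw [stdWord, List.toFinset_cons, ih]
    ext ⟨⟨a, ha⟩, b⟩
    simp only [initSegB, mem_insert, mem_filter, mem_univ, true_and, Prod.mk.injEq, Fin.mk.injEq]
    constructor
    · rintro (⟨rfl, rfl⟩ | ⟨h1, h2⟩)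
      · simp
      · exact ⟨h1, by omega⟩
    · rintro ⟨h1, h2⟩
      by_cases h3 : a = j
      · exact Or.inl ⟨h3, h1⟩
      · exact Or.inr ⟨h1, by omega⟩

lemma stdWord_length (n : ℕ) (j : ℕ) (h : j ≤ n) : (stdWord n j h).length = j := by
  induction j with
  | zero => rfl
  | succ j ih => rw [stdWord, List.length_cons, ih]

lemma monom_stdWord (n : ℕ) (j : ℕ) (h : j ≤ n) :
    monom n (flagSets (stdWord n j h)) = ∏ i ∈ Icc 1 j, tauB n (initSegB n i) := by
  induction j with
  | zero => simp [stdWord, flagSets, monom]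
  | succ j ih =>
    rw [Finset.prod_Icc_succ_top (by omega), stdWord, flagSets, monom_cons, ih, mul_comm]
    rw [← stdWord_toFinset n (j + 1) h, stdWord, List.toFinset_cons]

/-- Every complete flag represents the class of a point. -/
lemma monom_flagSets_eq_ptB {n : ℕ} (l : List (PM n)) (hl : ∀ p ∈ l, negPM p ∉ l)
    (hn : l.Nodup) (hc : l.length = n) : monom n (flagSets l) = ptB n := by
  induction h : l.countP (fun p => p.2 = false) generalizing l with
  | zero =>
    rw [ptB, ← monom_stdWord n n le_rfl]
    refine monom_flagSets_perm ?_ hl hn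
    have hsub : l ⊆ stdWord n n le_rfl := by
      intro p hp
      rw [← List.mem_toFinset, stdWord_toFinset]
      rw [List.countP_eq_zero] at h
      have := h p hp
      simpa [initSegB] using this
    exact List.Subperm.perm_of_length_le (hn.subperm hsub)
      ((stdWord_length n n le_rfl).trans hc.symm).le
  | succ m ih =>
    obtain ⟨x, hx, hx2⟩ := List.countP_pos_iff.1 (by omega : 0 < l.countP (fun p => p.2 = false))
    have hp : l.Perm (x :: l.erase x) := List.perm_cons_erase hx
    have hl' : ∀ p ∈ x :: l.erase x, negPM p ∉ x :: l.erase x := fun p h1 h2 =>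
      hl p (hp.mem_iff.2 h1) (hp.mem_iff.2 h2)
    have hn' := hp.nodup_iff.1 hn
    rw [monom_flagSets_perm hp hl hn, monom_flagSets_neg hl' hn' (by rw [← hp.length_eq, hc])]
    apply ih
    · exact forall_negPM_notMem_cons hl' hn'
    · rw [List.nodup_cons] at hn' ⊢
      exact ⟨fun h => hl' x (by simp) (List.mem_cons_of_mem _ h), hn'.2⟩
    · exact hp.length_eq.symm.trans hc
    · rw [hp.countP_eq, List.countP_cons] at h
      rw [List.countP_cons]
      simp only [decide_eq_true_eq] at hx2
      simp [negPM, hx2] at h ⊢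
      exact h

lemma IsAdmChain.of_cons {n : ℕ} {S : Finset (PM n)} {W : Multiset (Finset (PM n))}
    (h : IsAdmChain (S ::ₘ W)) : IsAdmChain W :=
  ⟨fun T hT => h.1 T (Multiset.mem_cons_of_mem hT), fun T hT U hU =>
    h.2 T (Multiset.mem_cons_of_mem hT) U (Multiset.mem_cons_of_mem hU)⟩

lemma IsAdmChain.cons {n : ℕ} {S : Finset (PM n)} {W : Multiset (Finset (PM n))}
    (h : IsAdmChain W) (hS : Adm n S) (hc : ∀ T ∈ W, S ⊆ T ∨ T ⊆ S) : IsAdmChain (S ::ₘ W) := by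
  constructor
  · intro T hT
    rcases Multiset.mem_cons.1 hT with rfl | hT
    exacts [hS, h.1 T hT]
  · intro T hT U hU
    rcases Multiset.mem_cons.1 hT with rfl | hT' <;> rcases Multiset.mem_cons.1 hU with rfl | hU'
    exacts [Or.inl Subset.rfl, hc U hU', (hc T hT').symm, h.2 T hT' U hU']

lemma IsAdmChain.ssubset_iff {n : ℕ} {S T : Finset (PM n)} {W : Multiset (Finset (PM n))}
    (h : IsAdmChain W) (hS : S ∈ W) (hT : T ∈ W) : S ⊂ T ↔ S.card < T.card := by
  refine ⟨card_lt_card, fun hc => ?_⟩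
  rcases h.2 S hS T hT with h1 | h1
  · exact h1.ssubset_of_ne (fun h2 => by simp [h2] at hc)
  · exact absurd (card_le_card h1) (by omega)

lemma IsAdmChain.eq_of_card_eq {n : ℕ} {S T : Finset (PM n)} {W : Multiset (Finset (PM n))}
    (h : IsAdmChain W) (hS : S ∈ W) (hT : T ∈ W) (hc : S.card = T.card) : S = T := by
  rcases h.2 S hS T hT with h1 | h1
  · exact eq_of_subset_of_card_le h1 hc.ge
  · exact (eq_of_subset_of_card_le h1 hc.le).symm

lemma exists_flagSets_eq {n : ℕ} (j : ℕ) (W : Multiset (Finset (PM n))) (hW : IsAdmChain W)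
    (hn : W.Nodup) (hj : ∀ S ∈ W, S.card ≤ j) (hc : W.card = j) :
    ∃ l : List (PM n), flagSets l = W ∧ l.length = j ∧ l.Nodup := by
  induction j generalizing W with
  | zero =>
    rw [Multiset.card_eq_zero] at hc
    exact ⟨[], by simp [flagSets, hc]⟩
  | succ j ih =>
    have hex : ∃ T ∈ W, T.card = j + 1 := by
      by_contra! hne
      have h1 : W.toFinset.card ≤ (Icc 1 j).card := by
        refine card_le_card_of_injOn Finset.card ?_ ?_
        · intro S hS
          have hS' : S ∈ W := by simpa using hS
          have h2 := hj S hS'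
          have h3 := hne S hS'
          have h4 := (hW.1 S hS').card_pos
          simp only [coe_Icc, Set.mem_Icc]
          omega
        · intro S hS T hT
          exact hW.eq_of_card_eq (by simpa using hS) (by simpa using hT)
      rw [Multiset.toFinset_card_of_nodup hn] at h1
      simp at h1
      omega
    obtain ⟨T, hT, hTc⟩ := hex
    obtain ⟨W', rfl⟩ := Multiset.exists_cons_of_mem hT
    rw [Multiset.nodup_cons] at hn
    obtain ⟨l, rfl, hl, hln⟩ := ih W' hW.of_cons hn.2 (fun S hS => by
      have h1 := hj S (Multiset.mem_cons_of_mem hS)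
      have h2 : S.card ≠ j + 1 := fun h => hn.1 <| by
        rw [hW.eq_of_card_eq hT (Multiset.mem_cons_of_mem hS) (hTc.trans h.symm)]
        exact hS
      omega) (by simpa using hc)
    have hlc : l.toFinset.card = j := by rw [List.toFinset_card_of_nodup hln, hl]
    have hsub : l.toFinset ⊆ T := by
      rcases toFinset_mem_flagSets l with h | h
      · simp [h]
      · rcases hW.2 _ hT _ (Multiset.mem_cons_of_mem h) with h1 | h1
        · have := card_le_card h1
          omega
        · exact h1
    have hd : (T \ l.toFinset).card = 1 := by
      rw [card_sdiff_of_subset hsub]; omega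
    obtain ⟨x, hx⟩ := card_eq_one.1 hd
    have hTx : insert x l.toFinset = T := by
      rw [← sdiff_union_of_subset hsub, hx]; rfl
    have hxl : x ∉ l := by
      have : x ∈ T \ l.toFinset := by simp [hx]
      simpa using (mem_sdiff.1 this).2
    exact ⟨x :: l, by rw [flagSets, hTx], by simp [hl], List.nodup_cons.2 ⟨hxl, hln⟩⟩

lemma monom_eq_ptB {n : ℕ} {W : Multiset (Finset (PM n))} (hW : IsAdmChain W)
    (hn : W.Nodup) (hc : W.card = n) : monom n W = ptB n := by
  obtain ⟨l, rfl, hl, hln⟩ := exists_flagSets_eq n W hW hn (fun S hS => (hW.1 S hS).card_le) hc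
  refine monom_flagSets_eq_ptB l ?_ hln hl
  intro p hp
  rcases toFinset_mem_flagSets l with h | h
  · simp at h
    simp [h] at hp
  · simpa using (hW.1 _ h).2 p (by simpa using hp)

lemma card_filter_Icc_card {α : Type*} [DecidableEq α] [Fintype α] {A B : Finset α} (h : A ⊆ B)
    (q : ℕ) (hq : A.card ≤ q) :
    (univ.filter (fun S : Finset α => A ⊆ S ∧ S ⊆ B ∧ S.card = q)).card =
      (B.card - A.card).choose (q - A.card) := by
  rw [← card_sdiff_of_subset h, ← card_powersetCard]
  refine card_bij' (fun S _ => S \ A) (fun S _ => S ∪ A) ?_ ?_ ?_ ?_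
  · intro S hS
    simp only [mem_filter, mem_univ, true_and] at hS
    rw [mem_powersetCard, card_sdiff_of_subset hS.1, hS.2.2]
    exact ⟨sdiff_subset_sdiff hS.2.1 Subset.rfl, rfl⟩
  · intro S hS
    rw [mem_powersetCard, subset_sdiff] at hS
    simp only [mem_filter, mem_univ, true_and]
    refine ⟨subset_union_right, union_subset hS.1.1 h, ?_⟩
    rw [card_union_of_disjoint hS.1.2, hS.2]
    omega
  · intro S hS
    simp only [mem_filter, mem_univ, true_and] at hS
    exact sdiff_union_of_subset hS.1
  · intro S hS
    rw [mem_powersetCard, subset_sdiff] at hS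
    rw [union_sdiff_right, sdiff_eq_self_of_disjoint hS.1.2]

lemma card_filter_full {n : ℕ} {T : Finset (PM n)} (hT : Adm n T) :
    (univ.filter (fun S : Finset (PM n) => Adm n S ∧ T ⊆ S ∧ S.card = n)).card =
      2 ^ (n - T.card) := by
  have h1 : (Fintype.piFinset (fun i : Fin n => univ.filter (fun b : Bool => (i, !b) ∉ T))).card =
      2 ^ (n - T.card) := by
    rw [Fintype.card_piFinset]
    have h2 : ∀ i : Fin n, (univ.filter (fun b : Bool => (i, !b) ∉ T)).card =
        if i ∈ T.image Prod.fst then 1 else 2 := by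
      intro i
      have h3 := hT.2 (i, true)
      simp only [negPM, Bool.not_true] at h3
      by_cases ht : (i, true) ∈ T <;> by_cases hf : (i, false) ∈ T
      · exact absurd hf (h3 ht)
      all_goals
        rw [Finset.card_filter, Fintype.sum_bool]
        simp [ht, hf]
    simp only [h2]
    rw [Finset.prod_ite]
    simp only [prod_const, one_pow, one_mul]
    congr 1
    have h4 : univ.filter (fun i : Fin n => ¬ i ∈ T.image Prod.fst) = (T.image Prod.fst)ᶜ := by
      ext; simp
    rw [h4, card_compl, card_image_of_injOn hT.injOn_fst, Fintype.card_fin]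
  rw [← h1]
  symm
  refine card_bij (fun f _ => univ.image fun i => (i, f i)) ?_ ?_ ?_
  · intro f hf
    simp only [Fintype.mem_piFinset, mem_filter, mem_univ, true_and] at hf
    have hsub : T ⊆ univ.image fun i => (i, f i) := by
      rintro ⟨i, b⟩ hb
      simp only [mem_image, mem_univ, true_and, Prod.mk.injEq]
      refine ⟨i, rfl, ?_⟩
      have := hf i
      by_contra hne
      apply this
      have : (!f i) = b := by cases h : f i <;> cases b <;> simp_all
      rwa [this]
    simp only [mem_filter, mem_univ, true_and]
    refine ⟨⟨hT.1.mono hsub, ?_⟩, hsub, ?_⟩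
    · simp [negPM]
    · rw [card_image_of_injective _ (fun i j h => (Prod.mk.inj h).1)]
      simp
  · intro f _ g _ h
    funext i
    have : (i, f i) ∈ univ.image fun i => (i, g i) := by
      rw [← h]; simp
    have h7 : g i = f i := by simpa using this
    exact h7.symm
  · intro S hS
    simp only [mem_filter, mem_univ, true_and] at hS
    obtain ⟨hSA, hTS, hSc⟩ := hS
    have h5 : S.image Prod.fst = univ := by
      apply eq_univ_of_card
      rw [card_image_of_injOn hSA.injOn_fst, hSc, Fintype.card_fin]
    have h6 : ∀ i : Fin n, ∃ b, (i, b) ∈ S := by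
      intro i
      have : i ∈ S.image Prod.fst := by simp [h5]
      obtain ⟨⟨a, b⟩, hb, rfl⟩ := mem_image.1 this
      exact ⟨b, hb⟩
    choose f hf using h6
    refine ⟨f, ?_, ?_⟩
    · simp only [Fintype.mem_piFinset, mem_filter, mem_univ, true_and]
      intro i hi
      exact hSA.2 _ (hf i) (hTS hi)
    · apply eq_of_subset_of_card_le
      · intro p hp
        obtain ⟨i, -, rfl⟩ := mem_image.1 hp
        exact hf i
      · rw [card_image_of_injective _ (fun i j h => (Prod.mk.inj h).1), hSc]
        simp

/-- The largest element of `K` below `p`, or `0`. -/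
def prevSize (K : Multiset ℕ) (p : ℕ) : ℕ := (K.toFinset.filter (· < p)).sup id

/-- The number of classes at `p` absorbed by the interval below `p`. -/
def excess (n : ℕ) (K : Multiset ℕ) (p : ℕ) : ℤ := (p : ℤ) + K.countP (p ≤ ·) - n - 1

/-- The contribution of `p` to the value of a chain with cardinalities `K`. -/
def factor (n : ℕ) (K : Multiset ℕ) (p : ℕ) : ℤ :=
  Cb (K.count p - 1) (excess n K p) * Cb (p - prevSize K p - 1) (excess n K p)

/-- The degree of the monomial of a chain with cardinalities `K`. -/
def chainVal (n : ℕ) (K : Multiset ℕ) : ℤ :=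
  2 ^ (n - K.toFinset.sup id) *
    ((-1) ^ (n + K.toFinset.card) * ∏ p ∈ K.toFinset, factor n K p)

lemma prevSize_eq {K : Multiset ℕ} {p q : ℕ} (hq : q ∈ K) (hqp : q < p)
    (h : ∀ x ∈ K, x < p → x ≤ q) : prevSize K p = q := by
  apply le_antisymm
  · refine Finset.sup_le fun x hx => ?_
    simp only [mem_filter, Multiset.mem_toFinset] at hx
    exact h x hx.1 hx.2
  · exact Finset.le_sup (f := id) (by simp [hq, hqp])

lemma prevSize_lt (K : Multiset ℕ) {p : ℕ} (hp : 0 < p) : prevSize K p < p := by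
  unfold prevSize
  rw [Finset.sup_lt_iff (by simpa using hp)]
  intro x hx
  exact (mem_filter.1 hx).2

lemma prevSize_cons_of_le {K : Multiset ℕ} {p q : ℕ} (h : p ≤ q) :
    prevSize (q ::ₘ K) p = prevSize K p := by
  unfold prevSize
  congr 1
  ext x
  simp only [mem_filter, Multiset.mem_toFinset, Multiset.mem_cons]
  constructor
  · rintro ⟨rfl | h1, h2⟩
    · omega
    · exact ⟨h1, h2⟩
  · tauto

lemma prevSize_cons_of_lt {K : Multiset ℕ} {p q r : ℕ} (hr : r ∈ K) (hqr : q ≤ r) (hrp : r < p) :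
    prevSize (q ::ₘ K) p = prevSize K p := by
  apply le_antisymm
  · refine Finset.sup_le fun x hx => ?_
    simp only [mem_filter, Multiset.mem_toFinset, Multiset.mem_cons] at hx
    obtain ⟨rfl | h1, h2⟩ := hx
    · exact hqr.trans (Finset.le_sup (f := id) (by simp [hr, hrp]))
    · exact Finset.le_sup (f := id) (by simp [h1, h2])
  · refine Finset.sup_mono fun x hx => ?_
    simp only [mem_filter, Multiset.mem_toFinset, Multiset.mem_cons] at hx ⊢
    tauto

lemma Cb_zero_left (c : ℤ) : Cb 0 c = if c = 0 then 1 else 0 := by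
  unfold Cb
  by_cases h : c = 0
  · simp [h]
  · rw [if_neg h, if_neg (by omega)]

lemma Cb_zero_right {x : ℤ} (h : 0 ≤ x) : Cb x 0 = 1 := by
  simp [Cb, h]

lemma Cb_self {x : ℤ} (h : 0 ≤ x) : Cb x x = 1 := by
  simp [Cb, h]

lemma Cb_of_neg {x c : ℤ} (h : c < 0) : Cb x c = 0 := by
  unfold Cb
  rw [if_neg (by omega)]

lemma Cb_of_lt {x c : ℤ} (h : x < c) : Cb x c = 0 := by
  unfold Cb
  rw [if_neg (by omega)]

lemma Cb_natCast (x c : ℕ) : Cb x c = x.choose c := by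
  unfold Cb
  split_ifs with h
  · simp
  · rw [Nat.choose_eq_zero_of_lt (by omega)]; simp

lemma Cb_symm (x c : ℤ) : Cb x (x - c) = Cb x c := by
  unfold Cb
  split_ifs with h1 h2 h2
  · obtain ⟨x, rfl⟩ := Int.eq_ofNat_of_zero_le (by omega : 0 ≤ x)
    obtain ⟨c, rfl⟩ := Int.eq_ofNat_of_zero_le (by omega : 0 ≤ c)
    rw [← Nat.cast_sub (by omega), Int.toNat_natCast, Int.toNat_natCast, Int.toNat_natCast,
      Nat.choose_symm (by omega)]
  · omega
  · omega
  · rfl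

lemma Cb_pascal {x c : ℤ} (h : 1 ≤ x) : Cb x c = Cb (x - 1) (c - 1) + Cb (x - 1) c := by
  rcases lt_trichotomy c 0 with hc | rfl | hc
  · rw [Cb_of_neg hc, Cb_of_neg (by omega), Cb_of_neg hc, add_zero]
  · rw [Cb_of_neg (by omega : (0 : ℤ) - 1 < 0)]
    simp [Cb, h, (by omega : 0 ≤ x)]
  · obtain ⟨x, rfl⟩ : ∃ y : ℕ, x = y + 1 := ⟨(x - 1).toNat, by omega⟩
    obtain ⟨c, rfl⟩ : ∃ y : ℕ, c = y + 1 := ⟨(c - 1).toNat, by omega⟩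
    simp only [add_sub_cancel_right]
    rw [← Nat.cast_succ, ← Nat.cast_succ, Cb_natCast, Cb_natCast, Cb_natCast]
    exact_mod_cast Nat.choose_succ_succ x c

lemma countP_le_of_forall {K : Multiset ℕ} {p q : ℕ} (h : ∀ x ∈ K, p ≤ x ↔ q ≤ x) :
    K.countP (p ≤ ·) = K.countP (q ≤ ·) :=
  Multiset.countP_congr rfl (by simpa using h)

lemma countP_le_eq_add {K : Multiset ℕ} {p q : ℕ} (hpq : p < q) (h : ∀ x ∈ K, p < x → q ≤ x) :
    K.countP (p ≤ ·) = K.countP (q ≤ ·) + K.count p := by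
  induction K using Multiset.induction_on with
  | empty => simp
  | cons a K ih =>
    have ih := ih fun x hx => h x (Multiset.mem_cons_of_mem hx)
    have ha := h a (Multiset.mem_cons_self a K)
    rw [Multiset.countP_cons, Multiset.countP_cons, Multiset.count_cons, ih]
    split_ifs <;> omega

lemma prod_factor_left {n : ℕ} {K : Multiset ℕ} {p q : ℕ} (hp : p ∈ K) (hq0 : 0 < q) (hqp : q < p)
    (h : ∀ x ∈ K, x < p → x < q) :
    ∏ x ∈ (q ::ₘ K).toFinset, factor n (q ::ₘ K) x =
      (if (q : ℤ) = p - excess n (p ::ₘ K) p then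
        Cb (K.count p - 1) (excess n (p ::ₘ K) p - 1) else 0) *
      ∏ x ∈ K.toFinset.erase p, factor n (p ::ₘ K) x := by
  have hqK : q ∉ K := fun hq => lt_irrefl _ (h q hq hqp)
  rw [Multiset.toFinset_cons, prod_insert (by simpa using hqK),
    ← mul_prod_erase _ _ (Multiset.mem_toFinset.2 hp), ← mul_assoc]
  congr 1
  · have h1 : K.countP (q ≤ ·) = K.countP (p ≤ ·) := countP_le_of_forall fun x hx =>
      ⟨fun h1 => by by_contra h2; have := h x hx (by omega); omega, fun h1 => by omega⟩
    have e1 : excess n (q ::ₘ K) q = q - p + excess n (p ::ₘ K) p := by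
      simp [excess, h1]; ring
    have e2 : excess n (q ::ₘ K) p = excess n (p ::ₘ K) p - 1 := by
      simp [excess, hqp]; ring
    have e3 : prevSize (q ::ₘ K) p = q := prevSize_eq (by simp) hqp (by
      intro x hx hxp
      rcases Multiset.mem_cons.1 hx with rfl | hx
      · rfl
      · exact (h x hx hxp).le)
    have e4 := prevSize_lt (q ::ₘ K) hq0
    unfold factor
    rw [e1, e2, e3, Multiset.count_cons_self, Multiset.count_cons_of_ne hqp.ne',
      Multiset.count_eq_zero_of_notMem hqK]
    simp only [zero_add, Nat.cast_one, sub_self]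
    rw [Cb_zero_left]
    generalize excess n (p ::ₘ K) p = c
    by_cases hc : (q : ℤ) = p - c
    · have hc0 : (q : ℤ) - p + c = 0 := by omega
      have hc1 : (p : ℤ) - q - 1 = c - 1 := by omega
      rw [if_pos hc, if_pos hc0, hc0, hc1, Cb_zero_right (by omega), Cb_self (by omega)]
      ring
    · rw [if_neg hc, if_neg (by omega)]
      ring
  · refine prod_congr rfl fun x hx => ?_
    simp only [mem_erase, Multiset.mem_toFinset] at hx
    have hxq : x ≠ q := fun h => hqK (h ▸ hx.2)
    unfold factor excess
    rw [Multiset.count_cons_of_ne hxq, Multiset.count_cons_of_ne hx.1, Multiset.countP_cons,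
      Multiset.countP_cons]
    rcases lt_or_gt_of_ne hx.1 with hlt | hlt
    · have := h x hx.2 hlt
      rw [if_pos this.le, if_pos hlt.le, prevSize_cons_of_le hlt.le, prevSize_cons_of_le this.le]
    · rw [if_neg (by omega), if_neg (by omega), prevSize_cons_of_lt hp hqp.le hlt,
        prevSize_cons_of_lt hp le_rfl hlt]

lemma prod_factor_right {n : ℕ} {K : Multiset ℕ} {p q : ℕ} (hp : p ∈ K) (hpq : p < q)
    (h : ∀ x ∈ K, p < x → q < x) :
    ∏ x ∈ (q ::ₘ K).toFinset, factor n (q ::ₘ K) x =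
      (if (q : ℤ) = p + K.count p - excess n (p ::ₘ K) p then
        Cb (K.count p - 1) (excess n (p ::ₘ K) p) *
          Cb (p - prevSize K p - 1) (excess n (p ::ₘ K) p) else 0) *
      ∏ x ∈ K.toFinset.erase p, factor n (q ::ₘ K) x := by
  have hqK : q ∉ K := fun hq => lt_irrefl _ (h q hq hpq)
  rw [Multiset.toFinset_cons, prod_insert (by simpa using hqK),
    ← mul_prod_erase _ _ (Multiset.mem_toFinset.2 hp), ← mul_assoc]
  congr 1
  have h1 : K.countP (p ≤ ·) = K.countP (q ≤ ·) + K.count p := by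
    refine countP_le_eq_add hpq fun x hx hpx => (h x hx hpx).le
  have e1 : excess n (q ::ₘ K) q = q - p - K.count p + excess n (p ::ₘ K) p := by
    simp [excess, h1]; ring
  have e2 : excess n (q ::ₘ K) p = excess n (p ::ₘ K) p := by
    simp [excess, hpq.le]
  have e3 : prevSize (q ::ₘ K) q = p := prevSize_eq (by simp [hp]) hpq (by
    intro x hx hxp
    rcases Multiset.mem_cons.1 hx with rfl | hx
    · omega
    · by_contra hpx
      have := h x hx (by omega)
      omega)
  unfold factor
  rw [e1, e2, e3, Multiset.count_cons_self, Multiset.count_cons_of_ne hpq.ne,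
    Multiset.count_eq_zero_of_notMem hqK, prevSize_cons_of_le hpq.le]
  simp only [zero_add, Nat.cast_one, sub_self]
  rw [Cb_zero_left]
  generalize excess n (p ::ₘ K) p = c
  by_cases hc : (q : ℤ) = p + K.count p - c
  · have hc0 : (q : ℤ) - p - K.count p + c = 0 := by omega
    rw [if_pos hc, if_pos hc0, hc0, Cb_zero_right (by omega)]
    ring
  · rw [if_neg hc, if_neg (by omega)]
    ring

lemma factor_cons_eq {n : ℕ} {K : Multiset ℕ} {p q x : ℕ} (hxp : x ≠ p) (hxq : x ≠ q)
    (hpq : p < q) (h : x < p ∨ ∃ y ∈ K, q ≤ y ∧ y < x) :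
    factor n (q ::ₘ K) x = factor n (p ::ₘ K) x := by
  unfold factor excess
  rw [Multiset.count_cons_of_ne hxq, Multiset.count_cons_of_ne hxp, Multiset.countP_cons,
    Multiset.countP_cons]
  rcases h with hlt | ⟨y, hy, hqy, hyx⟩
  · rw [if_pos (by omega), if_pos hlt.le, prevSize_cons_of_le hlt.le,
      prevSize_cons_of_le (by omega)]
  · rw [if_neg (by omega), if_neg (by omega), prevSize_cons_of_lt hy hqy hyx,
      prevSize_cons_of_lt hy (by omega) hyx]

/-- The value of a chain without the contribution of `p`. -/
def restVal (n : ℕ) (K : Multiset ℕ) (p : ℕ) : ℤ :=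
  2 ^ (n - K.toFinset.sup id) *
    ((-1) ^ (n + K.toFinset.card) * ∏ x ∈ K.toFinset.erase p, factor n (p ::ₘ K) x)

lemma chainVal_cons_self {n : ℕ} {K : Multiset ℕ} {p : ℕ} (hp : p ∈ K) :
    chainVal n (p ::ₘ K) = Cb (K.count p) (excess n (p ::ₘ K) p) *
      Cb (p - prevSize K p - 1) (excess n (p ::ₘ K) p) * restVal n K p := by
  have h1 : (p ::ₘ K).toFinset = K.toFinset := by
    rw [Multiset.toFinset_cons, insert_eq_of_mem (Multiset.mem_toFinset.2 hp)]
  unfold chainVal restVal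
  rw [h1, ← mul_prod_erase _ _ (Multiset.mem_toFinset.2 hp)]
  have h2 : factor n (p ::ₘ K) p = Cb (K.count p) (excess n (p ::ₘ K) p) *
      Cb (p - prevSize K p - 1) (excess n (p ::ₘ K) p) := by
    rw [factor, Multiset.count_cons_self, prevSize_cons_of_le le_rfl]
    simp
  rw [h2]
  ring

lemma toFinset_sup_cons {K : Multiset ℕ} {p q : ℕ} (hp : p ∈ K) (hqp : q ≤ p) :
    (q ::ₘ K).toFinset.sup id = K.toFinset.sup id := by
  rw [Multiset.toFinset_cons, sup_insert, id, sup_eq_right]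
  exact hqp.trans (Finset.le_sup (f := id) (by simpa using hp))

lemma chainVal_cons_left {n : ℕ} {K : Multiset ℕ} {p q : ℕ} (hp : p ∈ K) (hq0 : 0 < q)
    (hqp : q < p) (h : ∀ x ∈ K, x < p → x < q) :
    chainVal n (q ::ₘ K) = if (q : ℤ) = p - excess n (p ::ₘ K) p then
      -(Cb (K.count p - 1) (excess n (p ::ₘ K) p - 1) * restVal n K p) else 0 := by
  have hqK : q ∉ K := fun hq => lt_irrefl _ (h q hq hqp)
  have h1 : (q ::ₘ K).toFinset.card = K.toFinset.card + 1 := by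
    rw [Multiset.toFinset_cons, card_insert_of_notMem (by simpa using hqK)]
  rw [chainVal, prod_factor_left hp hq0 hqp h, toFinset_sup_cons hp hqp.le, h1, restVal]
  split_ifs <;> ring

lemma chainVal_cons_top {n : ℕ} {K : Multiset ℕ} {p q : ℕ} (hp : p ∈ K) (hpq : p < q)
    (h : ∀ x ∈ K, x ≤ p) :
    2 ^ (n - p) * chainVal n (q ::ₘ K) = if q = n then
      -(Cb (K.count p - 1) (excess n (p ::ₘ K) p) *
          Cb (p - prevSize K p - 1) (excess n (p ::ₘ K) p) * restVal n K p) else 0 := by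
  have hqK : q ∉ K := fun hq => absurd (h q hq) (by omega)
  have h1 : (q ::ₘ K).toFinset.card = K.toFinset.card + 1 := by
    rw [Multiset.toFinset_cons, card_insert_of_notMem (by simpa using hqK)]
  have hs : K.toFinset.sup id = p := le_antisymm
    (Finset.sup_le fun x hx => h x (by simpa using hx))
    (Finset.le_sup (f := id) (by simpa using hp))
  have hs' : (q ::ₘ K).toFinset.sup id = q := by
    rw [Multiset.toFinset_cons, sup_insert, hs, id, sup_eq_left]
    exact hpq.le
  have hc : K.countP (p ≤ ·) = K.count p := by
    rw [countP_le_eq_add hpq fun x hx hpx => absurd (h x hx) (by omega),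
      Multiset.countP_eq_zero.2 fun x hx hqx => absurd (h x hx) (by omega), zero_add]
  have he : excess n (p ::ₘ K) p = p + K.count p - n := by
    simp [excess, hc]; ring
  have hrest : ∏ x ∈ K.toFinset.erase p, factor n (q ::ₘ K) x =
      ∏ x ∈ K.toFinset.erase p, factor n (p ::ₘ K) x := by
    refine prod_congr rfl fun x hx => ?_
    simp only [mem_erase, Multiset.mem_toFinset] at hx
    have := h x hx.2
    exact factor_cons_eq hx.1 (by omega) hpq (Or.inl (by omega))
  rw [chainVal, prod_factor_right hp hpq fun x hx hpx => absurd (h x hx) (by omega), hs', h1,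
    restVal, hs, hrest]
  by_cases hq : q = n
  · rw [if_pos hq, if_pos (by rw [he]; omega), hq, Nat.sub_self]
    ring
  · rw [if_neg hq, if_neg (by rw [he]; omega)]
    ring

lemma factor_next {n : ℕ} {K : Multiset ℕ} {p q N : ℕ} (hpq : p ≤ q) (hqN : q < N)
    (h : ∀ x ∈ K, p < x → N ≤ x) :
    factor n (q ::ₘ K) N =
      Cb (K.count N - 1) (N - p - 1 - (K.count p - excess n (p ::ₘ K) p)) *
      Cb (N - q - 1) (N - p - 1 - (K.count p - excess n (p ::ₘ K) p)) := by
  have e1 : excess n (q ::ₘ K) N = N - p - 1 - (K.count p - excess n (p ::ₘ K) p) := by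
    have := countP_le_eq_add (hpq.trans_lt hqN) h
    simp [excess, hqN, this]
    ring
  have e2 : prevSize (q ::ₘ K) N = q := prevSize_eq (by simp) hqN (by
    intro x hx hxN
    rcases Multiset.mem_cons.1 hx with rfl | hx
    · rfl
    · by_contra hpx
      have := h x hx (by omega)
      omega)
  rw [factor, e1, e2, Multiset.count_cons_of_ne hqN.ne']

lemma restVal_eq_next {n : ℕ} {K : Multiset ℕ} {p N : ℕ} (hN : N ∈ K) (hpN : p < N)
    (h : ∀ x ∈ K, p < x → N ≤ x) :
    restVal n K p = 2 ^ (n - K.toFinset.sup id) * ((-1) ^ (n + K.toFinset.card) *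
      (Cb (K.count N - 1) (N - p - 1 - (K.count p - excess n (p ::ₘ K) p)) *
        Cb (N - p - 1) (K.count p - excess n (p ::ₘ K) p) *
        ∏ x ∈ (K.toFinset.erase p).erase N, factor n (p ::ₘ K) x)) := by
  rw [restVal, ← mul_prod_erase (K.toFinset.erase p) _ (a := N) (by simp [hN, hpN.ne']),
    factor_next le_rfl hpN h, Cb_symm]

lemma chainVal_cons_right {n : ℕ} {K : Multiset ℕ} {p q N : ℕ} (hp : p ∈ K) (hN : N ∈ K)
    (hpq : p < q) (hqN : q < N) (h : ∀ x ∈ K, p < x → N ≤ x) :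
    Cb (N - p - 1) (K.count p - excess n (p ::ₘ K) p) * chainVal n (q ::ₘ K) =
      if (q : ℤ) = p + K.count p - excess n (p ::ₘ K) p then
      -(Cb (K.count p - 1) (excess n (p ::ₘ K) p) *
          Cb (p - prevSize K p - 1) (excess n (p ::ₘ K) p) * restVal n K p) else 0 := by
  have hqK : q ∉ K := fun hq => absurd (h q hq hpq) (by omega)
  have h1 : (q ::ₘ K).toFinset.card = K.toFinset.card + 1 := by
    rw [Multiset.toFinset_cons, card_insert_of_notMem (by simpa using hqK)]
  have hrest : ∏ x ∈ (K.toFinset.erase p).erase N, factor n (q ::ₘ K) x =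
      ∏ x ∈ (K.toFinset.erase p).erase N, factor n (p ::ₘ K) x := by
    refine prod_congr rfl fun x hx => ?_
    simp only [mem_erase, Multiset.mem_toFinset] at hx
    refine factor_cons_eq hx.2.1 (fun h => hqK (h ▸ hx.2.2)) hpq ?_
    rcases lt_or_gt_of_ne hx.2.1 with h2 | h2
    · exact Or.inl h2
    · exact Or.inr ⟨N, hN, hqN.le, lt_of_le_of_ne (h x hx.2.2 h2) (Ne.symm hx.1)⟩
  rw [chainVal, prod_factor_right hp hpq fun x hx hpx => hqN.trans_le (h x hx hpx), h1,
    toFinset_sup_cons hN hqN.le, restVal_eq_next hN (hpq.trans hqN) h,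
    ← mul_prod_erase (K.toFinset.erase p) _ (a := N) (by simp [hN, (hpq.trans hqN).ne']), hrest,
    factor_next hpq.le hqN h]
  split_ifs with hq
  · have h2 : (N : ℤ) - q - 1 = N - p - 1 - (K.count p - excess n (p ::ₘ K) p) := by omega
    rw [h2, Cb_self (by omega)]
    ring
  · ring

lemma chainVal_of_nodup {n : ℕ} {K : Multiset ℕ} (hn : K.Nodup) (hc : K.card = n)
    (h : ∀ x ∈ K, 1 ≤ x ∧ x ≤ n) : chainVal n K = 1 := by
  have h1 : K.toFinset = Icc 1 n := by
    apply eq_of_subset_of_card_le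
    · intro x hx
      exact mem_Icc.2 (h x (by simpa using hx))
    · rw [Multiset.toFinset_card_of_nodup hn, hc]
      simp
  have h2 : K = (Icc 1 n).val := by
    rw [← h1, Multiset.toFinset_val, hn.dedup]
  have h3 : ∀ p ∈ Icc 1 n, factor n K p = 1 := by
    intro p hp
    rw [mem_Icc] at hp
    have e1 : K.count p = 1 := Multiset.count_eq_one_of_mem hn (by
      rw [h2]
      exact mem_Icc.2 hp)
    have e2 : excess n K p = 0 := by
      have : K.countP (p ≤ ·) = n + 1 - p := by
        rw [h2, Multiset.countP_eq_card_filter, ← Finset.filter_val, Finset.card_val]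
        have : (Icc 1 n).filter (p ≤ ·) = Icc p n := by
          ext x
          simp only [mem_filter, mem_Icc]
          omega
        rw [this, Nat.card_Icc]
      rw [excess, this]
      omega
    have e3 := prevSize_lt K (p := p) (by omega)
    rw [factor, e1, e2, Cb_zero_right (by simp), Cb_zero_right (by omega), one_mul]
  have h4 : (Icc 1 n).sup id = n := by
    apply le_antisymm
    · exact Finset.sup_le fun x hx => (mem_Icc.1 hx).2
    · rcases Nat.eq_zero_or_pos n with h0 | h0
      · omega
      · exact Finset.le_sup (f := id) (mem_Icc.2 ⟨h0, le_rfl⟩)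
  rw [chainVal, h1, h4, prod_congr rfl h3]
  simp [← two_mul]

lemma sum_ite_card {α : Type*} (F : Finset (Finset α)) (z v : ℤ) :
    (∑ S ∈ F, if (S.card : ℤ) = z then v else 0) =
      (F.filter fun S => (S.card : ℤ) = z).card * v := by
  rw [← Finset.sum_filter, sum_const, nsmul_eq_mul]

lemma card_map_eq {n : ℕ} {W : Multiset (Finset (PM n))} (S : Finset (PM n)) :
    (S ::ₘ W).map Finset.card = S.card ::ₘ W.map Finset.card := Multiset.map_cons _ _ _

/-- The largest member of a chain strictly below `T`. -/
lemma exists_pred {n : ℕ} {T : Finset (PM n)} {W : Multiset (Finset (PM n))} (hW : IsAdmChain W)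
    (hT : T ∈ W) : ∃ U, (U = ∅ ∨ U ∈ W) ∧ U.card = prevSize (W.map Finset.card) T.card ∧ U ⊂ T ∧
      ∀ S ∈ W, S ⊂ T → S ⊆ U := by
  by_cases hne : ∃ S ∈ W, S ⊂ T
  · obtain ⟨U, hU, hmax⟩ := (W.toFinset.filter (· ⊂ T)).exists_max_image Finset.card (by
      obtain ⟨S, hS, hST⟩ := hne
      exact ⟨S, by simp [hS, hST]⟩)
    simp only [mem_filter, Multiset.mem_toFinset] at hU hmax
    refine ⟨U, Or.inr hU.1, ?_, hU.2, ?_⟩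
    · symm
      refine prevSize_eq (Multiset.mem_map_of_mem _ hU.1) (card_lt_card hU.2) ?_
      intro x hx hxT
      obtain ⟨S, hS, rfl⟩ := Multiset.mem_map.1 hx
      exact hmax S ⟨hS, (hW.ssubset_iff hS hT).2 hxT⟩
    · intro S hS hST
      rcases hW.2 S hS U hU.1 with h | h
      · exact h
      · rw [eq_of_subset_of_card_le h (hmax S ⟨hS, hST⟩)]
  · push Not at hne
    refine ⟨∅, Or.inl rfl, ?_, (hW.1 T hT).1.empty_ssubset, fun S hS hST => absurd hST (hne S hS)⟩
    symm
    rw [card_empty, prevSize, ← Nat.bot_eq_zero, Finset.sup_eq_bot_iff]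
    intro x hx
    simp only [mem_filter, Multiset.mem_toFinset, Multiset.mem_map] at hx
    obtain ⟨⟨S, hS, rfl⟩, h2⟩ := hx
    exact absurd ((hW.ssubset_iff hS hT).2 h2) (hne S hS)

lemma exists_succ {n : ℕ} {T : Finset (PM n)} {W : Multiset (Finset (PM n))} (hW : IsAdmChain W)
    (hne : ∃ S ∈ W, T ⊂ S) : ∃ V ∈ W, T ⊂ V ∧ ∀ S ∈ W, T ⊂ S → V ⊆ S := by
  obtain ⟨V, hV, hmin⟩ := (W.toFinset.filter (T ⊂ ·)).exists_min_image Finset.card (by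
    obtain ⟨S, hS, hST⟩ := hne
    exact ⟨S, by simp [hS, hST]⟩)
  simp only [mem_filter, Multiset.mem_toFinset] at hV hmin
  refine ⟨V, hV.1, hV.2, fun S hS hST => ?_⟩
  rcases hW.2 S hS V hV.1 with h | h
  · rw [eq_of_subset_of_card_le h (hmin S ⟨hS, hST⟩)]
  · exact h

section Sums

variable {n : ℕ} {T : Finset (PM n)} {W : Multiset (Finset (PM n))}

lemma sum_chainVal_left (hW : IsAdmChain W) (hT : T ∈ W) {U : Finset (PM n)}
    (hUc : U.card = prevSize (W.map Finset.card) T.card) (hUT : U ⊂ T)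
    (hU : ∀ S ∈ W, S ⊂ T → S ⊆ U) {k : PM n} (hk : k ∈ T) (hkU : k ∉ U) {c : ℤ}
    (hc : c = excess n (T.card ::ₘ W.map Finset.card) T.card) :
    ∑ S with Adm n S ∧ insert k U ⊆ S ∧ S ⊂ T, chainVal n (S.card ::ₘ W.map Finset.card) =
      -(Cb ((W.map Finset.card).count T.card - 1) (c - 1) *
        Cb (T.card - prevSize (W.map Finset.card) T.card - 1) c *
        restVal n (W.map Finset.card) T.card) := by
  have hTK : T.card ∈ W.map Finset.card := Multiset.mem_map_of_mem _ hT
  have hcU : (insert k U).card = U.card + 1 := card_insert_of_notMem hkU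
  have h1 : ∀ S ∈ univ.filter (fun S => Adm n S ∧ insert k U ⊆ S ∧ S ⊂ T),
      chainVal n (S.card ::ₘ W.map Finset.card) = if (S.card : ℤ) = T.card - c then
        -(Cb ((W.map Finset.card).count T.card - 1) (c - 1) *
          restVal n (W.map Finset.card) T.card) else 0 := by
    intro S hS
    simp only [mem_filter, mem_univ, true_and] at hS
    rw [chainVal_cons_left hTK hS.1.card_pos (card_lt_card hS.2.2), ← hc]
    intro x hx hxT
    obtain ⟨R, hR, rfl⟩ := Multiset.mem_map.1 hx
    have h2 := card_le_card (hU R hR ((hW.ssubset_iff hR hT).2 hxT))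
    have h3 := card_le_card hS.2.1
    omega
  rw [sum_congr rfl h1, sum_ite_card]
  by_cases hc0 : c ≤ 0
  · rw [Cb_of_neg (by omega : c - 1 < 0)]
    ring
  have hTA := hW.1 T hT
  have hlt := card_lt_card hUT
  have h4 : ((univ.filter (fun S => Adm n S ∧ insert k U ⊆ S ∧ S ⊂ T)).filter
      (fun S => (S.card : ℤ) = T.card - c)).card =
      Cb (T.card - prevSize (W.map Finset.card) T.card - 1) c := by
    rw [← hUc]
    by_cases hcb : (T.card : ℤ) - U.card - 1 < c
    · rw [Cb_of_lt hcb, Nat.cast_eq_zero, card_eq_zero, filter_filter, filter_eq_empty_iff]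
      rintro S - ⟨⟨-, h2, -⟩, h3⟩
      have := card_le_card h2
      omega
    · obtain ⟨e, rfl⟩ := Int.eq_ofNat_of_zero_le (by omega : 0 ≤ c)
      have h5 := card_filter_Icc_card (insert_subset hk hUT.1) (T.card - e) (by omega)
      rw [hcU] at h5
      rw [filter_filter]
      have h6 : univ.filter (fun S => (Adm n S ∧ insert k U ⊆ S ∧ S ⊂ T) ∧
          (S.card : ℤ) = T.card - e) =
          univ.filter (fun S => insert k U ⊆ S ∧ S ⊆ T ∧ S.card = T.card - e) := by
        refine filter_congr fun S _ => ?_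
        constructor
        · rintro ⟨⟨-, h2, h3⟩, h4⟩
          exact ⟨h2, h3.1, by omega⟩
        · rintro ⟨h2, h3, h4⟩
          refine ⟨⟨hTA.of_subset h3 ⟨k, h2 (mem_insert_self _ _)⟩, h2,
            h3.ssubset_of_ne fun h => ?_⟩, by omega⟩
          rw [h] at h4
          omega
      rw [h6, h5, ← Cb_symm, ← Cb_natCast]
      congr 1 <;> push_cast [*] <;> omega
  rw [h4]
  ring

lemma sum_chainVal_right (hW : IsAdmChain W) (hT : T ∈ W) {V : Finset (PM n)} (hVW : V ∈ W)
    (hTV : T ⊂ V) (hV : ∀ S ∈ W, T ⊂ S → V ⊆ S) {l : PM n} (hl : l ∈ V) (hlT : l ∉ T) {c : ℤ}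
    (hc : c = excess n (T.card ::ₘ W.map Finset.card) T.card) :
    ∑ S with Adm n S ∧ T ⊂ S ∧ S ⊆ V.erase l, chainVal n (S.card ::ₘ W.map Finset.card) =
      -(Cb ((W.map Finset.card).count T.card - 1) c *
        Cb (T.card - prevSize (W.map Finset.card) T.card - 1) c *
        restVal n (W.map Finset.card) T.card) := by
  have hTK : T.card ∈ W.map Finset.card := Multiset.mem_map_of_mem _ hT
  have hVK : V.card ∈ W.map Finset.card := Multiset.mem_map_of_mem _ hVW
  have hcV : (V.erase l).card = V.card - 1 := card_erase_of_mem hl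
  have hlt := card_lt_card hTV
  have hnext : ∀ x ∈ W.map Finset.card, T.card < x → V.card ≤ x := by
    intro x hx hxT
    obtain ⟨R, hR, rfl⟩ := Multiset.mem_map.1 hx
    exact card_le_card (hV R hR ((hW.ssubset_iff hT hR).2 hxT))
  have hres := restVal_eq_next (n := n) hVK hlt hnext
  rw [← hc] at hres
  set m := (W.map Finset.card).count T.card with hm
  have hv : ∀ q : ℕ, T.card < q → q < V.card → (q : ℤ) ≠ T.card + m - c →
      chainVal n (q ::ₘ W.map Finset.card) = 0 := by
    intro q h1 h2 h3
    rw [chainVal, prod_factor_right hTK h1 fun x hx hxT => h2.trans_le (hnext x hx hxT), ← hc,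
      if_neg h3]
    ring
  by_cases he : c < m
  swap
  · rw [Cb_of_lt (by omega), sum_eq_zero]
    · ring
    · intro S hS
      simp only [mem_filter, mem_univ, true_and] at hS
      have h1 := card_lt_card hS.2.1
      have h2 := card_le_card hS.2.2
      exact hv _ h1 (by omega) (by omega)
  by_cases he2 : (V.card : ℤ) - T.card - 1 < m - c
  · rw [hres, Cb_of_lt he2, sum_eq_zero]
    · ring
    · intro S hS
      simp only [mem_filter, mem_univ, true_and] at hS
      have h1 := card_lt_card hS.2.1
      have h2 := card_le_card hS.2.2
      exact hv _ h1 (by omega) (by omega)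
  obtain ⟨e, he'⟩ := Int.eq_ofNat_of_zero_le (by omega : 0 ≤ m - c)
  have h1 : ∀ S ∈ univ.filter (fun S => Adm n S ∧ T ⊂ S ∧ S ⊆ V.erase l),
      chainVal n (S.card ::ₘ W.map Finset.card) = if (S.card : ℤ) = (T.card + e : ℕ) then
        chainVal n ((T.card + e) ::ₘ W.map Finset.card) else 0 := by
    intro S hS
    simp only [mem_filter, mem_univ, true_and] at hS
    split_ifs with h
    · rw [Nat.cast_inj] at h
      rw [h]
    · have h1 := card_lt_card hS.2.1
      have h2 := card_le_card hS.2.2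
      exact hv _ h1 (by omega) (by omega)
  rw [sum_congr rfl h1, sum_ite_card]
  have h3 := chainVal_cons_right (n := n) (q := T.card + e) hTK hVK (by omega) (by omega) hnext
  rw [← hc, ← hm, if_pos (by omega)] at h3
  rw [← h3]
  congr 1
  have h5 := card_filter_Icc_card (subset_erase.2 ⟨hTV.1, hlT⟩) (T.card + e) (by omega)
  rw [hcV] at h5
  have h6 : (univ.filter (fun S => Adm n S ∧ T ⊂ S ∧ S ⊆ V.erase l)).filter
      (fun S => (S.card : ℤ) = (T.card + e : ℕ)) =
      univ.filter (fun S => T ⊆ S ∧ S ⊆ V.erase l ∧ S.card = T.card + e) := by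
    rw [filter_filter]
    refine filter_congr fun S _ => ?_
    constructor
    · rintro ⟨⟨-, h2, h3⟩, h4⟩
      exact ⟨h2.1, h3, by omega⟩
    · rintro ⟨h2, h3, h4⟩
      refine ⟨⟨(hW.1 V hVW).of_subset (h3.trans (erase_subset _ _)) ((hW.1 T hT).1.mono h2),
        h2.ssubset_of_ne fun h => ?_, h3⟩, by omega⟩
      rw [← h] at h4
      omega
  rw [h6, h5, ← Cb_natCast]
  congr 1 <;> omega

lemma sum_chainVal_top (hW : IsAdmChain W) (hT : T ∈ W) (hV : ∀ S ∈ W, S ⊆ T) {c : ℤ}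
    (hc : c = excess n (T.card ::ₘ W.map Finset.card) T.card) :
    ∑ S with Adm n S ∧ T ⊂ S, chainVal n (S.card ::ₘ W.map Finset.card) =
      -(Cb ((W.map Finset.card).count T.card - 1) c *
        Cb (T.card - prevSize (W.map Finset.card) T.card - 1) c *
        restVal n (W.map Finset.card) T.card) := by
  have hTK : T.card ∈ W.map Finset.card := Multiset.mem_map_of_mem _ hT
  have hTA := hW.1 T hT
  have hmax : ∀ x ∈ W.map Finset.card, x ≤ T.card := by
    intro x hx
    obtain ⟨R, hR, rfl⟩ := Multiset.mem_map.1 hx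
    exact card_le_card (hV R hR)
  by_cases hn : T.card = n
  · have he : c = (W.map Finset.card).count T.card := by
      have h1 := countP_le_eq_add (K := W.map Finset.card) (Nat.lt_succ_self T.card)
        fun x hx hpx => absurd (hmax x hx) (by omega)
      have h0 : (W.map Finset.card).countP (T.card.succ ≤ ·) = 0 :=
        Multiset.countP_eq_zero.2 fun x hx hqx => absurd (hmax x hx) (by omega)
      rw [h0, zero_add] at h1
      rw [hc]
      simp [excess, h1]
      omega
    rw [he, Cb_of_lt (by omega), filter_eq_empty_iff.2, sum_empty]
    · ring
    · rintro S - ⟨h1, h2⟩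
      have := card_lt_card h2
      have := h1.card_le
      omega
  have hlt : T.card < n := lt_of_le_of_ne hTA.card_le hn
  have h1 : ∀ S ∈ univ.filter (fun S => Adm n S ∧ T ⊂ S),
      chainVal n (S.card ::ₘ W.map Finset.card) = if (S.card : ℤ) = n then
        chainVal n (n ::ₘ W.map Finset.card) else 0 := by
    intro S hS
    simp only [mem_filter, mem_univ, true_and] at hS
    split_ifs with h
    · rw [Nat.cast_inj] at h
      rw [h]
    · have h2 := chainVal_cons_top (n := n) hTK (card_lt_card hS.2) hmax
      rw [if_neg (by omega)] at h2
      simpa using h2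
  rw [sum_congr rfl h1, sum_ite_card]
  have h3 := chainVal_cons_top (n := n) hTK hlt hmax
  rw [if_pos rfl, ← hc] at h3
  rw [← h3]
  congr 1
  have h6 : (univ.filter (fun S => Adm n S ∧ T ⊂ S)).filter (fun S => (S.card : ℤ) = n) =
      univ.filter (fun S => Adm n S ∧ T ⊆ S ∧ S.card = n) := by
    rw [filter_filter]
    refine filter_congr fun S _ => ?_
    constructor
    · rintro ⟨⟨h1, h2⟩, h3⟩
      exact ⟨h1, h2.1, by omega⟩
    · rintro ⟨h1, h2, h3⟩
      refine ⟨⟨h1, h2.ssubset_of_ne fun h => hn (h ▸ h3)⟩, by omega⟩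
  rw [h6, card_filter_full hTA]
  simp

end Sums

/-- Every monomial of degree `n` supported on a chain, as a multiple of the class of a point. -/
theorem monom_eq_chainVal {n : ℕ} (W : Multiset (Finset (PM n))) (hW : IsAdmChain W)
    (hc : W.card = n) : monom n W = (chainVal n (W.map Finset.card) : RB n) * ptB n := by
  induction hN : n - W.toFinset.card using Nat.strong_induction_on generalizing W with
  | _ N ih =>
  by_cases hn : W.Nodup
  · rw [monom_eq_ptB hW hn hc, chainVal_of_nodup, Int.cast_one, one_mul]
    · exact hn.map_on fun S hS T hT h => hW.eq_of_card_eq hS hT h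
    · simpa using hc
    · intro x hx
      obtain ⟨R, hR, rfl⟩ := Multiset.mem_map.1 hx
      exact ⟨(hW.1 R hR).card_pos, (hW.1 R hR).card_le⟩
  obtain ⟨T, W', rfl, hT⟩ : ∃ T W', W = T ::ₘ W' ∧ T ∈ W' := by
    rw [Multiset.nodup_iff_ne_cons_cons] at hn
    push Not at hn
    obtain ⟨T, W₀, h⟩ := hn
    exact ⟨T, T ::ₘ W₀, h, Multiset.mem_cons_self _ _⟩
  have hW' := hW.of_cons
  have hTA := hW'.1 T hT
  rw [Multiset.card_cons] at hc
  have hstep : ∀ S, Adm n S → S ∉ W' → (∀ R ∈ W', S ⊆ R ∨ R ⊆ S) →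
      tauB n S * monom n W' =
        (chainVal n (S.card ::ₘ W'.map Finset.card) : RB n) * ptB n := by
    intro S hS hSW hSc
    rw [← monom_cons, ← card_map_eq]
    refine ih (n - (S ::ₘ W').toFinset.card) ?_ (S ::ₘ W') (hW'.cons hS hSc) (by simpa using hc) rfl
    have h1 : (T ::ₘ W').toFinset = W'.toFinset := by
      rw [Multiset.toFinset_cons, insert_eq_of_mem (Multiset.mem_toFinset.2 hT)]
    have h2 : (S ::ₘ W').toFinset.card = W'.toFinset.card + 1 := by
      rw [Multiset.toFinset_cons, card_insert_of_notMem (by simpa using hSW)]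
    have h3 := Multiset.toFinset_card_le W'
    rw [h1] at hN
    omega
  obtain ⟨U, hU, hUc, hUT, hUmax⟩ := exists_pred hW' hT
  obtain ⟨k, hk, hkU⟩ := exists_of_ssubset hUT
  have hleft : ∑ S with Adm n S ∧ insert k U ⊆ S ∧ S ⊂ T, tauB n S * monom n W' =
      ((∑ S with Adm n S ∧ insert k U ⊆ S ∧ S ⊂ T,
        chainVal n (S.card ::ₘ W'.map Finset.card) : ℤ) : RB n) * ptB n := by
    rw [Int.cast_sum, sum_mul]
    refine sum_congr rfl fun S hS => ?_
    simp only [mem_filter, mem_univ, true_and] at hS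
    have hkS : k ∈ S := hS.2.1 (mem_insert_self _ _)
    refine hstep S hS.1 (fun h => hkU (hUmax S h hS.2.2 hkS)) fun R hR => ?_
    rcases hW'.2 R hR T hT with h | h
    · by_cases hRT : R = T
      · exact Or.inl (hRT ▸ hS.2.2.1)
      · exact Or.inr ((hUmax R hR (h.ssubset_of_ne hRT)).trans
          ((subset_insert _ _).trans hS.2.1))
    · exact Or.inl (hS.2.2.1.trans h)
  rw [sum_chainVal_left hW' hT hUc hUT hUmax hk hkU rfl] at hleft
  have hm : 1 ≤ (W'.map Finset.card).count T.card :=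
    Multiset.one_le_count_iff_mem.2 (Multiset.mem_map_of_mem _ hT)
  have hpas := Cb_pascal (x := (W'.map Finset.card).count T.card)
    (c := excess n (T.card ::ₘ W'.map Finset.card) T.card) (by omega)
  rw [monom_cons, card_map_eq, chainVal_cons_self (Multiset.mem_map_of_mem _ hT), hpas]
  by_cases hne : ∃ S ∈ W', T ⊂ S
  · obtain ⟨V, hVW, hTV, hV⟩ := exists_succ hW' hne
    obtain ⟨l, hl, hlT⟩ := exists_of_ssubset hTV
    rw [tauB_mul_monom_mid hW' hT hU hVW hk hkU hl hlT, hleft]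
    have hright : ∑ S with Adm n S ∧ T ⊂ S ∧ S ⊆ V.erase l, tauB n S * monom n W' =
        ((∑ S with Adm n S ∧ T ⊂ S ∧ S ⊆ V.erase l,
          chainVal n (S.card ::ₘ W'.map Finset.card) : ℤ) : RB n) * ptB n := by
      rw [Int.cast_sum, sum_mul]
      refine sum_congr rfl fun S hS => ?_
      simp only [mem_filter, mem_univ, true_and] at hS
      have hlS : l ∉ S := fun h => notMem_erase _ _ (hS.2.2 h)
      refine hstep S hS.1 (fun h => hlS (hV S h hS.2.1 hl)) fun R hR => ?_
      rcases hW'.2 R hR T hT with h | h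
      · exact Or.inr (h.trans hS.2.1.1)
      · by_cases hRT : R = T
        · exact Or.inr (hRT ▸ hS.2.1.1)
        · exact Or.inl ((hS.2.2.trans (erase_subset _ _)).trans
            (hV R hR (h.ssubset_of_ne (Ne.symm hRT))))
    rw [hright, sum_chainVal_right hW' hT hVW hTV hV hl hlT rfl]
    push_cast
    ring
  · have hmax : ∀ S ∈ W', S ⊆ T := by
      intro S hS
      rcases hW'.2 S hS T hT with h | h
      · exact h
      · by_contra hST
        exact hne ⟨S, hS, h, hST⟩
    rw [tauB_mul_monom_top hW' hT hU hk hkU, hleft]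
    have hright : ∑ S with Adm n S ∧ T ⊂ S, tauB n S * monom n W' =
        ((∑ S with Adm n S ∧ T ⊂ S,
          chainVal n (S.card ::ₘ W'.map Finset.card) : ℤ) : RB n) * ptB n := by
      rw [Int.cast_sum, sum_mul]
      refine sum_congr rfl fun S hS => ?_
      simp only [mem_filter, mem_univ, true_and] at hS
      exact hstep S hS.1 (fun h => hS.2.2 (hmax S h)) fun R hR => Or.inr ((hmax R hR).trans hS.2.1)
    rw [hright, sum_chainVal_top hW' hT hmax rfl]
    push_cast
    ring


section Corners

variable {n : ℕ} {lam : ℕ → ℕ}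

lemma mem_cornerL {i : ℕ} :
    i ∈ cornerL n lam ↔ (1 ≤ i ∧ i ≤ n) ∧ lamE n lam (i + 1) < lamE n lam i := by
  simp [cornerL]

lemma iC_zero : iC n lam 0 = 0 := rfl

lemma iC_eq_getElem {r : ℕ} (h1 : 1 ≤ r) (h2 : r ≤ sC n lam) :
    iC n lam r = (cornerL n lam)[r - 1]'(by unfold sC at h2; omega) := by
  unfold sC at h2
  rw [iC, if_neg (by omega), List.getD_eq_getElem]

lemma iC_mem {r : ℕ} (h1 : 1 ≤ r) (h2 : r ≤ sC n lam) : iC n lam r ∈ cornerL n lam := by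
  rw [iC_eq_getElem h1 h2]
  exact List.getElem_mem _

lemma iC_of_lt {r : ℕ} (h : sC n lam < r) : iC n lam r = n + 1 := by
  unfold sC at h
  rw [iC, if_neg (by omega), List.getD_eq_default _ _ (by omega)]

lemma iC_lt_iC {r t : ℕ} (h1 : r < t) (h2 : t ≤ sC n lam + 1) : iC n lam r < iC n lam t := by
  have hpos : 0 < iC n lam t := by
    rcases h2.lt_or_eq with h | h
    · have := (mem_cornerL.1 (iC_mem (n := n) (lam := lam) (r := t) (by omega) (by omega))).1
      omega
    · rw [iC_of_lt (by omega)]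
      omega
  rcases Nat.eq_zero_or_pos r with rfl | hr
  · exact hpos
  rcases h2.lt_or_eq with h | h
  · rw [iC_eq_getElem hr (by omega), iC_eq_getElem (by omega) (by omega)]
    have hs : (cornerL n lam).SortedLT := Finset.sortedLT_sort _
    exact hs.getElem_lt_getElem_of_lt (by omega)
  · rw [iC_of_lt (r := t) (by omega)]
    have := (mem_cornerL.1 (iC_mem (n := n) (lam := lam) hr (by omega))).1
    omega

lemma exists_iC_eq {i : ℕ} (h : i ∈ cornerL n lam) :
    ∃ r, 1 ≤ r ∧ r ≤ sC n lam ∧ iC n lam r = i := by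
  obtain ⟨j, hj, rfl⟩ := List.getElem_of_mem h
  have hs : j + 1 ≤ sC n lam := hj
  exact ⟨j + 1, by omega, hs, by rw [iC_eq_getElem (by omega) hs]; rfl⟩

lemma iC_succ_le {r i : ℕ} (h : i ∈ cornerL n lam) (hr : iC n lam r < i) :
    iC n lam (r + 1) ≤ i := by
  obtain ⟨t, ht1, ht2, rfl⟩ := exists_iC_eq h
  by_contra hlt
  push Not at hlt
  rcases le_or_gt t r with h1 | h1
  · rcases h1.lt_or_eq with h2 | rfl
    · rcases le_or_gt r (sC n lam) with h3 | h3
      · exact absurd (iC_lt_iC (n := n) (lam := lam) h2 (by omega)) (by omega)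
      · rw [iC_of_lt h3] at hr
        have := (mem_cornerL.1 h).1
        omega
    · omega
  · rcases (Nat.succ_le_of_lt h1).lt_or_eq with h2 | h2
    · exact absurd (iC_lt_iC (n := n) (lam := lam) h2 (by omega))
        (by simp only [Nat.succ_eq_add_one]; omega)
    · rw [← h2] at hlt
      exact lt_irrefl _ hlt

lemma lam_eq_of_forall_notMem (hanti : ∀ i j, 1 ≤ i → i ≤ j → j ≤ n → lam j ≤ lam i) {i j : ℕ}
    (hi : 1 ≤ i) (hij : i ≤ j) (hj : j ≤ n) (h : ∀ x ∈ cornerL n lam, i ≤ x → j ≤ x) :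
    lam i = lam j := by
  induction j, hij using Nat.le_induction with
  | base => rfl
  | succ j hij ih =>
    have h1 : j ∉ cornerL n lam := fun hx => absurd (h j hx hij) (by omega)
    rw [mem_cornerL, lamE, lamE, if_pos hj, if_pos (by omega)] at h1
    have h2 := hanti j (j + 1) (by omega) (by omega) hj
    rw [ih (by omega) fun x hx hix => by have := h x hx hix; omega]
    omega

/-- The values of `lam` around a corner. -/
lemma lam_compare_iC (hanti : ∀ i j, 1 ≤ i → i ≤ j → j ≤ n → lam j ≤ lam i) {r : ℕ} (h1 : 1 ≤ r)
    (h2 : r ≤ sC n lam) {x : ℕ} (hx : 1 ≤ x) (hxn : x ≤ n) :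
    (x ≤ iC n lam (r - 1) → lam (iC n lam r) < lam x) ∧
    (iC n lam (r - 1) < x → x ≤ iC n lam r → lam x = lam (iC n lam r)) ∧
    (iC n lam r < x → lam x < lam (iC n lam r)) := by
  have hdrop : ∀ t, 1 ≤ t → t ≤ sC n lam → ∀ y, iC n lam t < y → y ≤ n →
      lam y < lam (iC n lam t) := by
    intro t ht1 ht2 y hy hyn
    obtain ⟨h3, h4⟩ := mem_cornerL.1 (iC_mem ht1 ht2)
    rw [lamE, lamE, if_pos (by omega), if_pos (by omega)] at h4
    exact (hanti _ _ (by omega) hy hyn).trans_lt h4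
  have hle := (mem_cornerL.1 (iC_mem h1 h2)).1
  refine ⟨fun h => ?_, fun h3 h4 => ?_, fun h => hdrop r h1 h2 x h hxn⟩
  · have hr : r - 1 ≠ 0 := by
      intro h0
      rw [h0, iC_zero] at h
      omega
    have h5 := hdrop (r - 1) (by omega) (by omega) (iC n lam r)
      (iC_lt_iC (by omega) (by omega)) hle.2
    have h6 := iC_lt_iC (n := n) (lam := lam) (r := r - 1) (t := r) (by omega) (by omega)
    exact h5.trans_le (hanti _ _ hx h (by omega))
  · refine lam_eq_of_forall_notMem hanti hx h4 hle.2 fun y hy hxy => ?_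
    have := iC_succ_le hy (h3.trans_le hxy)
    rwa [Nat.sub_add_cancel h1] at this

lemma lamE_iC {r : ℕ} (h1 : 1 ≤ r) (h2 : r ≤ sC n lam) :
    lamE n lam (iC n lam r) = lam (iC n lam r) := by
  rw [lamE, if_pos (mem_cornerL.1 (iC_mem h1 h2)).1.2]

lemma mem_map_Icc {x : ℕ} :
    x ∈ (Icc 1 n).val.map lam ↔ ∃ i, (1 ≤ i ∧ i ≤ n) ∧ lam i = x := by
  simp [Multiset.mem_map]

lemma prevSize_map_lam (hanti : ∀ i j, 1 ≤ i → i ≤ j → j ≤ n → lam j ≤ lam i)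
    (hpos : ∀ i, 1 ≤ i → i ≤ n → 1 ≤ lam i) {r : ℕ} (h1 : 1 ≤ r) (h2 : r ≤ sC n lam) :
    prevSize ((Icc 1 n).val.map lam) (lam (iC n lam r)) = lamE n lam (iC n lam (r + 1)) := by
  have hle := (mem_cornerL.1 (iC_mem h1 h2)).1
  rcases h2.lt_or_eq with h3 | h3
  · have hle' := (mem_cornerL.1 (iC_mem (r := r + 1) (by omega) h3)).1
    have hlt := iC_lt_iC (n := n) (lam := lam) (r := r) (t := r + 1) (by omega) (by omega)
    rw [lamE_iC (by omega) h3]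
    refine prevSize_eq (mem_map_Icc.2 ⟨_, hle', rfl⟩)
      ((lam_compare_iC hanti h1 h2 hle'.1 hle'.2).2.2 hlt) fun x hx hxr => ?_
    obtain ⟨i, hi, rfl⟩ := mem_map_Icc.1 hx
    have hri : iC n lam r < i := by
      by_contra h
      exact absurd (hanti _ _ hi.1 (not_lt.1 h) hle.2) (by omega)
    have h4 := lam_compare_iC hanti (r := r + 1) (by omega) h3 hi.1 hi.2
    rw [Nat.add_sub_cancel] at h4
    rcases le_or_gt i (iC n lam (r + 1)) with h | h
    · exact (h4.2.1 hri h).le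
    · exact (h4.2.2 h).le
  · rw [iC_of_lt (r := r + 1) (by omega), lamE, if_neg (by omega), prevSize, ← Nat.bot_eq_zero,
      Finset.sup_eq_bot_iff]
    intro x hx
    rw [mem_filter, Multiset.mem_toFinset] at hx
    obtain ⟨i, hi, rfl⟩ := mem_map_Icc.1 hx.1
    have hri : iC n lam r < i := by
      by_contra h
      exact absurd (hanti _ _ hi.1 (not_lt.1 h) hle.2) (by omega)
    have hn : n ∈ cornerL n lam := by
      refine mem_cornerL.2 ⟨⟨by omega, le_rfl⟩, ?_⟩
      rw [lamE, lamE, if_neg (by omega), if_pos le_rfl]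
      exact hpos n (by omega) le_rfl
    have := iC_succ_le hn (hri.trans_le hi.2)
    rw [iC_of_lt (r := r + 1) (by omega)] at this
    omega

lemma count_map_lam (hanti : ∀ i j, 1 ≤ i → i ≤ j → j ≤ n → lam j ≤ lam i) {r : ℕ} (h1 : 1 ≤ r)
    (h2 : r ≤ sC n lam) :
    ((Icc 1 n).val.map lam).count (lam (iC n lam r)) = iC n lam r - iC n lam (r - 1) := by
  have hle := (mem_cornerL.1 (iC_mem h1 h2)).1
  rw [Multiset.count_map, ← Finset.filter_val, Finset.card_val, ← Nat.card_Ioc]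
  congr 1
  ext x
  simp only [mem_filter, mem_Icc, mem_Ioc]
  constructor
  · rintro ⟨hx, h3⟩
    have h4 := lam_compare_iC hanti h1 h2 hx.1 hx.2
    constructor
    · by_contra h
      exact absurd (h4.1 (by omega)) (by omega)
    · by_contra h
      exact absurd (h4.2.2 (by omega)) (by omega)
  · rintro ⟨h3, h4⟩
    exact ⟨by omega, ((lam_compare_iC hanti h1 h2 (by omega) (by omega)).2.1 h3 h4).symm⟩

lemma countP_map_lam (hanti : ∀ i j, 1 ≤ i → i ≤ j → j ≤ n → lam j ≤ lam i) {r : ℕ} (h1 : 1 ≤ r)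
    (h2 : r ≤ sC n lam) :
    ((Icc 1 n).val.map lam).countP (lam (iC n lam r) ≤ ·) = iC n lam r := by
  have hle := (mem_cornerL.1 (iC_mem h1 h2)).1
  rw [Multiset.countP_map, ← Finset.filter_val, Finset.card_val,
    show iC n lam r = (Icc 1 (iC n lam r)).card by simp]
  congr 1
  ext x
  simp only [mem_filter, mem_Icc, Nat.card_Icc, Nat.add_sub_cancel]
  constructor
  · rintro ⟨hx, h3⟩
    refine ⟨hx.1, ?_⟩
    by_contra h
    exact absurd ((lam_compare_iC hanti h1 h2 hx.1 hx.2).2.2 (by omega)) (by omega)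
  · rintro ⟨h3, h4⟩
    exact ⟨by omega, hanti _ _ h3 h4 hle.2⟩

lemma factor_map_lam (hanti : ∀ i j, 1 ≤ i → i ≤ j → j ≤ n → lam j ≤ lam i)
    (hpos : ∀ i, 1 ≤ i → i ≤ n → 1 ≤ lam i) {r : ℕ} (h1 : 1 ≤ r) (h2 : r ≤ sC n lam) :
    factor n ((Icc 1 n).val.map lam) (lam (iC n lam r)) = yC n lam r := by
  have hlt := iC_lt_iC (n := n) (lam := lam) (r := r - 1) (t := r) (by omega) (by omega)
  rw [factor, excess, yC, aC, bC, cC, prevSize_map_lam hanti hpos h1 h2, count_map_lam hanti h1 h2,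
    countP_map_lam hanti h1 h2, lamE_iC h1 h2, Nat.cast_sub hlt.le]

lemma bijOn_lam_iC (hanti : ∀ i j, 1 ≤ i → i ≤ j → j ≤ n → lam j ≤ lam i)
    (hpos : ∀ i, 1 ≤ i → i ≤ n → 1 ≤ lam i) :
    Set.BijOn (fun r => lam (iC n lam r)) (Icc 1 (sC n lam))
      ((Icc 1 n).val.map lam).toFinset := by
  refine ⟨?_, ?_, ?_⟩
  · intro r hr
    simp only [coe_Icc, Set.mem_Icc] at hr
    rw [mem_coe, Multiset.mem_toFinset]
    exact mem_map_Icc.2 ⟨_, (mem_cornerL.1 (iC_mem hr.1 hr.2)).1, rfl⟩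
  · have h : StrictAntiOn (fun r => lam (iC n lam r)) (Icc 1 (sC n lam) : Finset ℕ) := by
      intro r hr t ht hrt
      simp only [coe_Icc, Set.mem_Icc] at hr ht
      have hle := (mem_cornerL.1 (iC_mem ht.1 ht.2)).1
      exact (lam_compare_iC hanti hr.1 hr.2 hle.1 hle.2).2.2 (iC_lt_iC hrt (by omega))
    exact h.injOn
  · intro x hx
    rw [mem_coe, Multiset.mem_toFinset] at hx
    obtain ⟨i, hi, rfl⟩ := mem_map_Icc.1 hx
    have hn : n ∈ cornerL n lam := by
      refine mem_cornerL.2 ⟨⟨by omega, le_rfl⟩, ?_⟩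
      rw [lamE, lamE, if_neg (by omega), if_pos le_rfl]
      exact hpos n (by omega) le_rfl
    have hex : ∃ j, j ∈ cornerL n lam ∧ i ≤ j := ⟨n, hn, hi.2⟩
    obtain ⟨h1, h2⟩ := Nat.find_spec hex
    obtain ⟨r, hr1, hr2, hr⟩ := exists_iC_eq h1
    refine ⟨r, by simp [hr1, hr2], ?_⟩
    simp only [hr]
    exact (lam_eq_of_forall_notMem hanti hi.1 h2 (mem_cornerL.1 h1).1.2
      fun y hy hiy => Nat.find_min' hex ⟨hy, hiy⟩).symm

lemma IY_eq_prod_factor (hanti : ∀ i j, 1 ≤ i → i ≤ j → j ≤ n → lam j ≤ lam i)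
    (hpos : ∀ i, 1 ≤ i → i ≤ n → 1 ≤ lam i) :
    IY n lam = (-1) ^ (n + ((Icc 1 n).val.map lam).toFinset.card) *
      ∏ p ∈ ((Icc 1 n).val.map lam).toFinset, factor n ((Icc 1 n).val.map lam) p := by
  have hb := bijOn_lam_iC hanti hpos
  have hcard := Finset.card_nbij _ hb.mapsTo hb.injOn hb.surjOn
  rw [Nat.card_Icc, Nat.add_sub_cancel] at hcard
  rw [IY, ← hcard]
  congr 1
  refine Finset.prod_nbij _ hb.mapsTo hb.injOn hb.surjOn fun r hr => ?_
  rw [mem_Icc] at hr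
  exact (factor_map_lam hanti hpos hr.1 hr.2).symm

end Corners

section Family

variable {n : ℕ}

lemma adm_sSet (hn : 1 ≤ n) {u : Equiv.Perm (PM n)} (hu : IsSigned u) {i : ℕ} (hi : 1 ≤ i) :
    Adm n (sSet n u i) := by
  constructor
  · exact ⟨u (⟨0, hn⟩, true), mem_image_of_mem (fun k => u (k, true)) (by simp; omega)⟩
  · intro p hp hq
    simp only [sSet, mem_image, mem_filter, mem_univ, true_and] at hp hq
    obtain ⟨k, -, rfl⟩ := hp
    obtain ⟨l, -, h⟩ := hq
    rw [← hu] at h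
    simpa [negPM] using u.injective h

lemma monom_map_val {ι : Type*} (F : Finset ι) (f : ι → Finset (PM n)) :
    monom n (F.val.map f) = ∏ i ∈ F, tauB n (f i) := by
  rw [monom, Multiset.map_map]
  rfl

lemma monom_add (V W : Multiset (Finset (PM n))) : monom n (V + W) = monom n V * monom n W := by
  simp [monom]

lemma card_BAscents (u : Equiv.Perm (PM n)) :
    (BDescents n u).card + (BAscents n u).card = n := by
  unfold BDescents BAscents
  rw [card_filter_add_card_filter_not, Nat.card_Icc, Nat.add_sub_cancel]

/-- A monomial whose support is not a chain vanishes. -/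
lemma monom_eq_zero_of_incomparable {W : Multiset (Finset (PM n))} (hW : ∀ S ∈ W, Adm n S)
    {S T : Finset (PM n)} (hS : S ∈ W) (hT : T ∈ W) (h1 : ¬ S ⊆ T) (h2 : ¬ T ⊆ S) :
    monom n W = 0 := by
  obtain ⟨W', rfl⟩ := Multiset.exists_cons_of_mem hS
  rcases Multiset.mem_cons.1 hT with rfl | hT
  · exact absurd subset_rfl h1
  rw [monom_cons]
  exact tauB_mul_monom_eq_zero (hW S hS) (hW T (Multiset.mem_cons_of_mem hT)) hT h1 h2

/-- A family of pairwise comparable sets can be listed as an increasing sequence. -/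
lemma exists_chain_enum {α : Type*} {W : Multiset (Finset α)} (hc : W.card = n)
    (h : ∀ S ∈ W, ∀ T ∈ W, S ⊆ T ∨ T ⊆ S) :
    ∃ S : ℕ → Finset α, W = (Icc 1 n).val.map S ∧
      ∀ i j, 1 ≤ i → i ≤ j → j ≤ n → S i ⊆ S j := by
  induction n generalizing W with
  | zero =>
    refine ⟨fun _ => ∅, ?_, fun i j hi hij hj => absurd hj (by omega)⟩
    rw [Multiset.card_eq_zero.1 hc]
    simp
  | succ m ih =>
    classical
    have hne : W.toFinset.Nonempty := by
      obtain ⟨T, hT⟩ := Multiset.card_pos_iff_exists_mem.1 (by omega : 0 < W.card)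
      exact ⟨T, by simpa using hT⟩
    obtain ⟨T, hT, hmax⟩ := W.toFinset.exists_max_image Finset.card hne
    simp only [Multiset.mem_toFinset] at hT hmax
    obtain ⟨W', rfl⟩ := Multiset.exists_cons_of_mem hT
    obtain ⟨S, rfl, hS⟩ := ih (W := W') (by simpa using hc) fun A hA B hB =>
      h A (Multiset.mem_cons_of_mem hA) B (Multiset.mem_cons_of_mem hB)
    have hST : ∀ i, 1 ≤ i → i ≤ m → S i ⊆ T := by
      intro i h1 h2
      have hi : S i ∈ T ::ₘ (Icc 1 m).val.map S := by
        refine Multiset.mem_cons_of_mem (Multiset.mem_map_of_mem _ ?_)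
        simp [h1, h2]
      rcases h _ hi T hT with h3 | h3
      · exact h3
      · rw [eq_of_subset_of_card_le h3 (hmax _ hi)]
    refine ⟨fun i => if i ≤ m then S i else T, ?_, ?_⟩
    · rw [← insert_Icc_right_eq_Icc_add_one (by omega), insert_val_of_notMem (by simp),
        Multiset.map_cons, if_neg (by omega)]
      congr 1
      refine Multiset.map_congr rfl fun i hi => ?_
      rw [if_pos]
      exact (mem_Icc.1 hi).2
    · intro i j hi hij hj
      simp only
      split_ifs with h1 h2 h2
      · exact hS i j hi hij h2
      · exact hST i hi h1
      · omega
      · exact subset_rfl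

lemma monom_eq_IY (hn : 1 ≤ n) {S : ℕ → Finset (PM n)}
    (hA : ∀ T ∈ (Icc 1 n).val.map S, Adm n T)
    (hS : ∀ i j, 1 ≤ i → i ≤ j → j ≤ n → S i ⊆ S j) :
    monom n ((Icc 1 n).val.map S) =
      ((2 ^ (n - (S n).card) * IY n (fun i => (S (n + 1 - i)).card) : ℤ) : RB n) * ptB n := by
  have hmem : ∀ i, 1 ≤ i → i ≤ n → S i ∈ (Icc 1 n).val.map S := fun i h1 h2 =>
    Multiset.mem_map_of_mem _ (by simp [h1, h2])
  have hchain : IsAdmChain ((Icc 1 n).val.map S) := by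
    refine ⟨hA, fun A hA B hB => ?_⟩
    obtain ⟨i, hi, rfl⟩ := Multiset.mem_map.1 hA
    obtain ⟨j, hj, rfl⟩ := Multiset.mem_map.1 hB
    rw [mem_val, mem_Icc] at hi hj
    rcases le_total i j with h | h
    · exact Or.inl (hS i j hi.1 h hj.2)
    · exact Or.inr (hS j i hj.1 h hi.2)
  rw [monom_eq_chainVal _ hchain (by simp)]
  have hrev : ((Icc 1 n).val.map S).map Finset.card =
      (Icc 1 n).val.map fun i => (S (n + 1 - i)).card := by
    have himg : (Icc 1 n).val.map (fun i => n + 1 - i) = (Icc 1 n).val := by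
      rw [← image_val_of_injOn]
      · congr 1
        ext x
        simp only [mem_image, mem_Icc]
        constructor
        · rintro ⟨y, hy, rfl⟩
          omega
        · intro hx
          exact ⟨n + 1 - x, by omega, by omega⟩
      · intro x hx y hy hxy
        simp only [coe_Icc, Set.mem_Icc] at hx hy hxy
        omega
    conv_lhs => rw [← himg]
    rw [Multiset.map_map, Multiset.map_map]
    rfl
  have hsup : (((Icc 1 n).val.map S).map Finset.card).toFinset.sup id = (S n).card := by
    apply le_antisymm
    · refine Finset.sup_le fun x hx => ?_
      simp only [Multiset.mem_toFinset, Multiset.mem_map, mem_val, mem_Icc] at hx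
      obtain ⟨-, ⟨i, hi, rfl⟩, rfl⟩ := hx
      exact card_le_card (hS i n hi.1 hi.2 le_rfl)
    · exact Finset.le_sup (f := id)
        (Multiset.mem_toFinset.2 (Multiset.mem_map_of_mem _ (hmem n hn le_rfl)))
  rw [chainVal, hsup, hrev, IY_eq_prod_factor]
  · intro i j hi hij hj
    exact card_le_card (hS _ _ (by omega) (by omega) (by omega))
  · intro i h1 h2
    exact (hA _ (hmem _ (by omega) (by omega))).card_pos

end Family

end TypeB

/-- Let `u, v, w` be signed permutations of `[n]` with `d(u) + d(v) = d(w)`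
(`d` counting B-descents), and consider the family (with multiplicity) of the sets `u[i]` for
B-descents `i` of `u`, `v[i]` for B-descents `i` of `v`, and `w[i]` for B-ascents `i` of `w`.
If the family can be ordered into a chain `S_1 ⊆ … ⊆ S_n`, then
`[X_u][X_v][Y^w] = 2^{n−λ_1} I(λ) · τ_{{1}} ⋯ τ_{{1,…,n}}` in `R^B_n`, where `λ` consists of the
cardinalities `|S_i|` in weakly decreasing order; otherwise `[X_u][X_v][Y^w] = 0`. -/
theorem typeB_triple_intersection (n : ℕ) (hn : 1 ≤ n)
    (u v w : Equiv.Perm (PM n))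
    (hu : IsSigned u) (hv : IsSigned v) (hw : IsSigned w)
    (hd : (BDescents n u).card + (BDescents n v).card = (BDescents n w).card) :
    (∀ S : ℕ → Finset (PM n),
        ((BDescents n u).val.map (sSet n u) + (BDescents n v).val.map (sSet n v) +
            (BAscents n w).val.map (sSet n w)) = (Finset.Icc 1 n).val.map S →
        (∀ i j, 1 ≤ i → i ≤ j → j ≤ n → S i ⊆ S j) →
        (∏ i ∈ BDescents n u, tauB n (sSet n u i)) * (∏ i ∈ BDescents n v, tauB n (sSet n v i)) *
            (∏ i ∈ BAscents n w, tauB n (sSet n w i)) =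
          ((2 ^ (n - (S n).card) * IY n (fun i => (S (n + 1 - i)).card) : ℤ) : RB n) * ptB n)
    ∧ ((¬ ∃ S : ℕ → Finset (PM n),
          ((BDescents n u).val.map (sSet n u) + (BDescents n v).val.map (sSet n v) +
              (BAscents n w).val.map (sSet n w)) = (Finset.Icc 1 n).val.map S ∧
          (∀ i j, 1 ≤ i → i ≤ j → j ≤ n → S i ⊆ S j)) →
        (∏ i ∈ BDescents n u, tauB n (sSet n u i)) * (∏ i ∈ BDescents n v, tauB n (sSet n v i)) *
            (∏ i ∈ BAscents n w, tauB n (sSet n w i)) = 0) := by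
  have hprod : (∏ i ∈ BDescents n u, tauB n (sSet n u i)) *
      (∏ i ∈ BDescents n v, tauB n (sSet n v i)) * (∏ i ∈ BAscents n w, tauB n (sSet n w i)) =
      TypeB.monom n ((BDescents n u).val.map (sSet n u) + (BDescents n v).val.map (sSet n v) +
        (BAscents n w).val.map (sSet n w)) := by
    simp only [TypeB.monom_add, TypeB.monom_map_val]
  have hadm : ∀ S ∈ (BDescents n u).val.map (sSet n u) + (BDescents n v).val.map (sSet n v) +
      (BAscents n w).val.map (sSet n w), Adm n S := by
    intro S hS
    simp only [Multiset.mem_add, Multiset.mem_map, Finset.mem_val] at hS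
    rcases hS with (⟨i, hi, rfl⟩ | ⟨i, hi, rfl⟩) | ⟨i, hi, rfl⟩
    · exact TypeB.adm_sSet hn hu (Finset.mem_Icc.1 (Finset.mem_filter.1 hi).1).1
    · exact TypeB.adm_sSet hn hv (Finset.mem_Icc.1 (Finset.mem_filter.1 hi).1).1
    · exact TypeB.adm_sSet hn hw (Finset.mem_Icc.1 (Finset.mem_filter.1 hi).1).1
  have hcard : ((BDescents n u).val.map (sSet n u) + (BDescents n v).val.map (sSet n v) +
      (BAscents n w).val.map (sSet n w)).card = n := by
    simp only [Multiset.card_add, Multiset.card_map, Finset.card_val]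
    rw [hd, TypeB.card_BAscents]
  rw [hprod]
  constructor
  · intro S hS hchain
    rw [hS] at hadm ⊢
    exact TypeB.monom_eq_IY hn hadm hchain
  · intro h
    by_contra hne
    refine h (TypeB.exists_chain_enum hcard fun S hS T hT => ?_)
    by_contra hST
    push Not at hST
    exact hne (TypeB.monom_eq_zero_of_incomparable hadm hS hT hST.1 hST.2)
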